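/- For every Δ > 0 there exist constants C₁ ≥ 1, c > 0 and a positive integer r, depending only on Δ, with the following property. Let P be a set of n points and L a set of m lines in ℝ² with m ≤ n²/C₁ and n ≤ m²/C₁, and suppose |I(P,L)| ≥ Δ n^{2/3} m^{2/3}. Then there exists a subset P' ⊆ P with |P'| ≥ c·n such that the configuration (P', L) is r-rigid. -/

import Mathlib

noncomputable section

open MvPolynomial

/-- Flatten a tuple of points of `ℂ²` indexed by `S` into a point of affine
space with coordinates indexed by `S × Fin 2`. -/
def flatten {S : Type*} (Q : S → ℂ × ℂ) : S × Fin 2 → ℂ :=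
  fun v => if v.2 = 0 then (Q v.1).1 else (Q v.1).2

/-- A subset of `(ℂ²)^S` is Zariski closed if it is the common zero locus of a
family of polynomials in the `2|S|` coordinates. -/
def ZClosed {S : Type*} (V : Set (S → ℂ × ℂ)) : Prop :=
  ∃ I : Set (MvPolynomial (S × Fin 2) ℂ),
    V = {Q | ∀ f ∈ I, eval (flatten Q) f = 0}

/-- A subset of `(ℂ²)^S` is irreducible if it is Zariski closed, nonempty, and
is not covered by two Zariski closed sets without being inside one of them. -/
def ZIrred {S : Type*} (V : Set (S → ℂ × ℂ)) : Prop :=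
  ZClosed V ∧ V.Nonempty ∧
    ∀ V₁ V₂ : Set (S → ℂ × ℂ), ZClosed V₁ → ZClosed V₂ → V ⊆ V₁ ∪ V₂ →
      V ⊆ V₁ ∨ V ⊆ V₂

/-- `V` is an irreducible component of `K`: an irreducible closed subset of `K`
that is maximal among irreducible closed subsets of `K`. -/
def IsIrredComponent {S : Type*} (K V : Set (S → ℂ × ℂ)) : Prop :=
  ZIrred V ∧ V ⊆ K ∧ ∀ W : Set (S → ℂ × ℂ), ZIrred W → W ⊆ K → V ⊆ W → V = W

/-- The (Krull) dimension of `V` is at most `r`: every strictly increasing chain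
`c 0 ⊂ c 1 ⊂ ⋯ ⊂ c k` of irreducible closed subsets of `V` has `k ≤ r`. -/
def ZDimLE {S : Type*} (V : Set (S → ℂ × ℂ)) (r : ℕ) : Prop :=
  ∀ (k : ℕ) (c : Fin (k + 1) → Set (S → ℂ × ℂ)),
    (∀ i, ZIrred (c i)) → (∀ i, c i ⊆ V) → StrictMono c → k ≤ r

/-- The variety `K_T ⊆ (ℂ²)^S` of tuples of points satisfying the collinearity
conditions given by the triples in `T`. -/
def KT {S : Type*} (T : Set (Set S)) : Set (S → ℂ × ℂ) :=
  {Q | ∀ t ∈ T, Collinear ℂ (Q '' t)}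

/-- `P ∈ K_T` is `r`-rigid with respect to `T` if every irreducible component of
`K_T` containing `P` has dimension at most `r`. -/
def IsRigid {S : Type*} (T : Set (Set S)) (P : S → ℂ × ℂ) (r : ℕ) : Prop :=
  P ∈ KT T ∧
    ∀ V : Set (S → ℂ × ℂ), IsIrredComponent (KT T) V → P ∈ V → ZDimLE V r


/-- `l ⊆ ℝ²` is a line if it is the solution set of a nontrivial affine equation. -/
def IsLine (l : Set (ℝ × ℝ)) : Prop :=
  ∃ a b c : ℝ, (a, b) ≠ (0, 0) ∧ l = {p : ℝ × ℝ | a * p.1 + b * p.2 = c}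

/-- The set of incidences between a set of points `P` and a set of lines `L`. -/
def Incidences (P : Set (ℝ × ℝ)) (L : Set (Set (ℝ × ℝ))) :
    Set ((ℝ × ℝ) × Set (ℝ × ℝ)) :=
  {pl | pl.1 ∈ P ∧ pl.2 ∈ L ∧ pl.1 ∈ pl.2}

/-- The natural embedding `ℝ² ⊆ ℂ²`. -/
def emb (p : ℝ × ℝ) : ℂ × ℂ := ((p.1 : ℂ), (p.2 : ℂ))

/-- `T_L`: the collection of 3-element subsets of `P` lying on a common line
of `L`. -/
def TL (P : Set (ℝ × ℝ)) (L : Set (Set (ℝ × ℝ))) : Set (Set ↥P) :=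
  {t : Set ↥P | t.ncard = 3 ∧ ∃ l ∈ L, ∀ p ∈ t, (p : ℝ × ℝ) ∈ l}

/-- The point-line configuration `(P, L)` is `r`-rigid: the tuple of points of
`P` (indexed by itself, viewed inside `ℂ²`) is `r`-rigid with respect to the
collinear triples `T_L` determined by `L`. -/
def ConfigRigid (P : Set (ℝ × ℝ)) (L : Set (Set (ℝ × ℝ))) (r : ℕ) : Prop :=
  IsRigid (TL P L) (fun p : ↥P => emb (p : ℝ × ℝ)) r

theorem trdeg_lt_of_surjective_of_not_injective {k A B : Type} [Field k] [CommRing A] [IsDomain A]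
    [CommRing B] [IsDomain B] [Algebra k A] [Algebra k B] [Algebra.FiniteType k A]
    (f : A →ₐ[k] B) (hf : Function.Surjective f) (hinj : ¬ Function.Injective f) :
    Algebra.trdeg k B < Algebra.trdeg k A := by
  by_contra hle
  rw [not_lt] at hle
  obtain ⟨ι, x, hx⟩ := exists_isTranscendenceBasis' k B
  choose y hy using fun i => hf (x i)
  have hfy : (fun i => f (y i)) = x := funext hy
  have hind : AlgebraicIndependent k y := AlgebraicIndependent.of_comp f (by
    show AlgebraicIndependent k (fun i => f (y i))
    rw [hfy]; exact hx.1)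
  have hcard : Algebra.trdeg k B = Cardinal.mk ι := hx.cardinalMk_eq_trdeg.symm
  have hyb : IsTranscendenceBasis k y := hind.isTranscendenceBasis_of_trdeg_le
    (trdeg_lt_aleph0_of_finiteType) (hcard ▸ hle)
  have halg : Algebra.IsAlgebraic (Algebra.adjoin k (Set.range y)) A := hyb.isAlgebraic
  obtain ⟨a, ha, ha0⟩ : ∃ a, f a = 0 ∧ a ≠ 0 := by
    by_contra! h
    exact hinj ((injective_iff_map_eq_zero f).2 h)
  have hne := Ideal.comap_ne_bot_of_algebraic_mem (R := Algebra.adjoin k (Set.range y))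
    (I := RingHom.ker f) ha0 ha (halg.isAlgebraic a)
  obtain ⟨z, hz, hz0⟩ := Submodule.exists_mem_ne_zero_of_ne_bot hne
  obtain ⟨P, hP⟩ : ∃ P : MvPolynomial ι k, aeval y P = (z : A) := by
    exact (Algebra.adjoin_range_eq_range_aeval k y).le z.2
  have hfz : f (z : A) = 0 := hz
  rw [← hP, ← AlgHom.comp_apply, comp_aeval] at hfz
  have hP0 : P = 0 := by
    have h := hx.1
    rw [algebraicIndependent_iff] at h
    refine h P ?_
    rw [← hfy]; exact hfz
  apply hz0
  ext
  rw [← hP, hP0]; simp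

theorem Derivation.apply_aeval {σ R R' A M : Type*} [Fintype σ] [CommRing R] [CommRing R']
    [CommRing A] [Algebra R R'] [Algebra R' A] [Algebra R A] [IsScalarTower R R' A]
    [AddCommGroup M] [Module A M] [Module R' M] (D : Derivation R' A M)
    (x : σ → A) (f : MvPolynomial σ R) :
    D (aeval x f) = ∑ s, aeval x (pderiv s f) • D (x s) := by
  classical
  induction f using MvPolynomial.induction_on with
  | C a =>
    have h : algebraMap R A a = algebraMap R' A (algebraMap R R' a) :=
      IsScalarTower.algebraMap_apply R R' A a
    simp [h]
  | add p q hp hq => simp [hp, hq, add_smul, Finset.sum_add_distrib]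
  | mul_X p i hp =>
    simp only [map_mul, aeval_X, Derivation.leibniz, hp, Finset.smul_sum, pderiv_X, smul_eq_mul,
      map_add, add_smul, Finset.sum_add_distrib, smul_smul]
    congr 1
    rw [Finset.sum_eq_single i]
    · simp
    · intro b _ hb
      simp [hb.symm]
    · simp

theorem trdeg_le_of_derivation_eq_zero {σ K k : Type} {n : ℕ} [Field k] [CharZero k] [Field K]
    [Algebra k K] (A : Type) [CommRing A] [Algebra k A] [Algebra A K] [IsFractionRing A K]
    [IsScalarTower k A K] [Algebra.FiniteType k A]
    (x : σ → A) (hx : Algebra.adjoin k (Set.range x) = ⊤) (y : Fin n → K)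
    (h : ∀ D : Derivation (IntermediateField.adjoin k (Set.range y)) K
      (Ω[K⁄IntermediateField.adjoin k (Set.range y)]),
      (∀ j, D (y j) = 0) → ∀ s, D (algebraMap A K (x s)) = 0) :
    Algebra.trdeg k K ≤ n := by
  set K0 := IntermediateField.adjoin k (Set.range y) with hK0
  have hess : Algebra.EssFiniteType k K := by
    have : Algebra.EssFiniteType A K := .of_isLocalization _ (nonZeroDivisors A)
    exact .comp k A K
  have hess' : Algebra.EssFiniteType K0 K := .of_comp k K0 K
  let D : Derivation K0 K (Ω[K⁄K0]) := KaehlerDifferential.D K0 K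
  have hDx := h D (fun j => by
    have : y j = algebraMap K0 K ⟨y j, IntermediateField.subset_adjoin _ _ ⟨j, rfl⟩⟩ := rfl
    rw [this, Derivation.map_algebraMap])
  have hA : ∀ a : A, D (algebraMap A K a) = 0 := by
    intro a
    have ha : a ∈ Algebra.adjoin k (Set.range x) := hx ▸ trivial
    induction ha using Algebra.adjoin_induction with
    | mem z hz => obtain ⟨s, rfl⟩ := hz; exact hDx s
    | algebraMap r =>
      rw [← IsScalarTower.algebraMap_apply k A K, IsScalarTower.algebraMap_apply k K0 K]
      exact D.map_algebraMap _
    | add a b _ _ ha hb => simp [ha, hb]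
    | mul a b _ _ ha hb => simp [ha, hb]
  have hD : ∀ z, D z = 0 := by
    intro z
    have : IsDomain A := (IsFractionRing.injective A K).isDomain (algebraMap A K)
    obtain ⟨a, b, hb, rfl⟩ := IsFractionRing.div_surjective (A := A) z
    have hb0 : algebraMap A K b ≠ 0 := IsFractionRing.to_map_ne_zero_of_mem_nonZeroDivisors hb
    have h1 := hA a
    have h2 : D (algebraMap A K b * (algebraMap A K a / algebraMap A K b)) = 0 := by
      rw [mul_div_cancel₀ _ hb0]; exact h1
    rw [Derivation.leibniz, hA b, smul_zero, add_zero, smul_eq_zero] at h2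
    exact h2.resolve_left hb0
  have hunr : Algebra.FormallyUnramified K0 K := by
    constructor
    refine ⟨fun u v => ?_⟩
    have : ∀ w : Ω[K⁄K0], w = 0 := by
      intro w
      have hw : w ∈ Submodule.span K (Set.range (KaehlerDifferential.D K0 K)) := by
        rw [KaehlerDifferential.span_range_derivation]; trivial
      induction hw using Submodule.span_induction with
      | mem z hz => obtain ⟨s, rfl⟩ := hz; exact hD s
      | zero => rfl
      | add a b _ _ ha hb => rw [ha, hb, add_zero]
      | smul r a _ ha => rw [ha, smul_zero]
    rw [this u, this v]
  have hsep := (Algebra.FormallyUnramified.iff_isSeparable K0 K).1 hunr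
  have halg : Algebra.IsAlgebraic K0 K := inferInstance
  have halg2 : Algebra.IsAlgebraic (Algebra.adjoin k (Set.range y)) K := by
    open IntermediateField.algebraAdjoinAdjoin in
    exact (IsFractionRing.comap_isAlgebraic_iff
      (A := Algebra.adjoin k (Set.range y)) (K := K0) (C := K)).2 halg
  refine (Algebra.IsAlgebraic.trdeg_le_cardinalMk k (Set.range y)).trans ?_
  refine Cardinal.mk_range_le.trans ?_
  simp

theorem eq_zero_of_sum_smul_eq_zero {σ ι K V : Type*} [Fintype σ] [DecidableEq σ] [Fintype ι]
    [Field K] [AddCommGroup V] [Module K V] (B : Matrix σ ι K) (N : Matrix ι σ K)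
    (hdet : (B * N).det ≠ 0) (w : σ → V) (h : ∀ a, ∑ s, N a s • w s = 0) (r : σ) : w r = 0 := by
  have hrow (t : σ) : ∑ s, (B * N) t s • w s = 0 := by
    simp only [Matrix.mul_apply, Finset.sum_smul, mul_smul]
    rw [Finset.sum_comm]
    refine Finset.sum_eq_zero fun a _ => ?_
    rw [← Finset.smul_sum, h, smul_zero]
  have h3 : ∑ t, (B * N).adjugate r t • ∑ s, (B * N) t s • w s = 0 :=
    Finset.sum_eq_zero fun t _ => by rw [hrow, smul_zero]
  simp only [Finset.smul_sum, smul_smul] at h3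
  rw [Finset.sum_comm] at h3
  simp only [← Finset.sum_smul, ← Matrix.mul_apply, Matrix.adjugate_mul] at h3
  rw [Finset.sum_eq_single r] at h3
  · simp only [Matrix.smul_apply, Matrix.one_apply_eq, smul_eq_mul, mul_one] at h3
    exact (smul_eq_zero.1 h3).resolve_left hdet
  · intro s _ hs
    simp [Matrix.one_apply_ne hs.symm]
  · simp

theorem trdeg_quotient_le_of_tangent {σ ι : Type} [Fintype σ] [Fintype ι]
    (𝔭 : Ideal (MvPolynomial σ ℂ)) [𝔭.IsPrime] (z : σ → ℂ) (hz : ∀ f ∈ 𝔭, eval z f = 0)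
    (F : ι → MvPolynomial σ ℂ) (hF : ∀ i, F i ∈ 𝔭) {n : ℕ} (φ : Fin n → σ → ℂ)
    (h : ∀ u : σ → ℂ, (∀ i, ∑ s, eval z (pderiv s (F i)) * u s = 0) →
      (∀ j, ∑ s, φ j s * u s = 0) → u = 0) :
    Algebra.trdeg ℂ (MvPolynomial σ ℂ ⧸ 𝔭) ≤ n := by
  classical
  let A := MvPolynomial σ ℂ ⧸ 𝔭
  let K := FractionRing A
  let x : σ → A := fun s => Ideal.Quotient.mkₐ ℂ 𝔭 (X s)
  let xK : σ → K := fun s => algebraMap A K (x s)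
  let π : MvPolynomial σ ℂ →ₐ[ℂ] K := aeval xK
  have hπ : ∀ f, π f = algebraMap A K (Ideal.Quotient.mkₐ ℂ 𝔭 f) := by
    intro f
    have : π = (IsScalarTower.toAlgHom ℂ A K).comp (Ideal.Quotient.mkₐ ℂ 𝔭) := by
      ext s
      simp only [π, xK, x, aeval_X, AlgHom.comp_apply, IsScalarTower.coe_toAlgHom']
    rw [this]; rfl
  let N : Matrix (ι ⊕ Fin n) σ (MvPolynomial σ ℂ) :=
    Matrix.of (Sum.elim (fun i s => pderiv s (F i)) (fun j s => C (φ j s)))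
  let Nz : Matrix (ι ⊕ Fin n) σ ℂ := N.map (eval z)
  have hinj : LinearMap.ker (Matrix.toLin' Nz) = ⊥ := by
    rw [LinearMap.ker_eq_bot']
    intro u hu
    rw [Matrix.toLin'_apply] at hu
    refine h u (fun i => ?_) (fun j => ?_)
    · simpa [Nz, N, Matrix.mulVec, dotProduct] using congrFun hu (Sum.inl i)
    · simpa [Nz, N, Matrix.mulVec, dotProduct] using congrFun hu (Sum.inr j)
  obtain ⟨g, hg⟩ := LinearMap.exists_leftInverse_of_injective _ hinj
  let B : Matrix σ (ι ⊕ Fin n) ℂ := LinearMap.toMatrix' g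
  have hB : B * Nz = 1 := by
    have := congrArg LinearMap.toMatrix' hg
    rwa [LinearMap.toMatrix'_comp, LinearMap.toMatrix'_toLin', LinearMap.toMatrix'_id] at this
  let Bc : Matrix σ (ι ⊕ Fin n) (MvPolynomial σ ℂ) := B.map C
  let M : Matrix σ σ (MvPolynomial σ ℂ) := Bc * N
  have hM : eval z M.det = 1 := by
    rw [RingHom.map_det]
    have : (eval z).mapMatrix M = B * Nz := by
      simp only [M, RingHom.mapMatrix_apply, Matrix.map_mul, Nz]
      congr 1
      ext i j; simp [Bc]
    rw [this, hB, Matrix.det_one]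
  have hdet : π M.det ≠ 0 := by
    rw [hπ]
    intro h0
    have h1 : Ideal.Quotient.mkₐ ℂ 𝔭 M.det = 0 :=
      IsFractionRing.injective A K (by rw [h0, map_zero])
    have h2 : M.det ∈ 𝔭 := by rwa [Ideal.Quotient.mkₐ_eq_mk, Ideal.Quotient.eq_zero_iff_mem] at h1
    exact one_ne_zero (hM.symm.trans (hz _ h2))
  let y : Fin n → K := fun j => π (∑ s, C (φ j s) * X s)
  have hgen : Algebra.adjoin ℂ (Set.range x) = ⊤ := by
    have h1 : x = Ideal.Quotient.mkₐ ℂ 𝔭 ∘ X := rfl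
    rw [h1, Set.range_comp, ← AlgHom.map_adjoin, MvPolynomial.adjoin_range_X, Algebra.map_top]
    exact (AlgHom.range_eq_top _).2 (Ideal.Quotient.mkₐ_surjective _ _)
  have key : Algebra.trdeg ℂ K ≤ n := by
    refine trdeg_le_of_derivation_eq_zero (σ := σ) A x hgen y ?_
    intro D hD
    have hrow : ∀ a, ∑ s, π (N a s) • D (xK s) = 0 := by
      rintro (i | j)
      · have h1 := D.apply_aeval xK (F i)
        have h2 : aeval xK (F i) = (0 : K) := by
          show π (F i) = 0
          rw [hπ]
          have : Ideal.Quotient.mkₐ ℂ 𝔭 (F i) = 0 := by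
            rw [Ideal.Quotient.mkₐ_eq_mk, Ideal.Quotient.eq_zero_iff_mem]; exact hF i
          rw [this, map_zero]
        rw [h2, map_zero] at h1
        exact h1.symm
      · have h1 := D.apply_aeval xK (∑ s, C (φ j s) * X s)
        rw [show aeval xK (∑ s, C (φ j s) * X s) = y j from rfl, hD j] at h1
        rw [h1]
        refine Finset.sum_congr rfl fun s _ => ?_
        congr 2
        simp [N, pderiv_X, Pi.single_apply]
    refine eq_zero_of_sum_smul_eq_zero (Bc.map π) (N.map π) ?_ (fun s => D (xK s)) hrow
    rw [← Matrix.map_mul]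
    rwa [AlgHom.map_det] at hdet
  refine le_trans ?_ key
  exact trdeg_le_of_injective (IsScalarTower.toAlgHom ℂ A K) (IsFractionRing.injective A K)

/-- The ideal of polynomials vanishing on a set of tuples of points of `ℂ²`. -/
def zeroIdeal {S : Type} (V : Set (S → ℂ × ℂ)) : Ideal (MvPolynomial (S × Fin 2) ℂ) where
  carrier := {f | ∀ Q ∈ V, eval (flatten Q) f = 0}
  add_mem' hf hg Q hQ := by rw [map_add, hf Q hQ, hg Q hQ, add_zero]
  zero_mem' Q _ := map_zero _
  smul_mem' a f hf Q hQ := by rw [smul_eq_mul, map_mul, hf Q hQ, mul_zero]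

theorem zeroIdeal_anti {S : Type} {V W : Set (S → ℂ × ℂ)} (h : V ⊆ W) :
    zeroIdeal W ≤ zeroIdeal V := fun _ hf Q hQ => hf Q (h hQ)

theorem ZClosed.subset_of_zeroIdeal_le {S : Type} {V W : Set (S → ℂ × ℂ)} (hV : ZClosed V)
    (h : zeroIdeal V ≤ zeroIdeal W) : W ⊆ V := by
  obtain ⟨I, rfl⟩ := hV
  intro Q hQ f hf
  exact h (fun Q' hQ' => hQ' f hf) Q hQ

theorem ZIrred.isPrime_zeroIdeal {S : Type} {V : Set (S → ℂ × ℂ)} (hV : ZIrred V) :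
    (zeroIdeal V).IsPrime := by
  obtain ⟨_, ⟨Q0, hQ0⟩, hirr⟩ := hV
  constructor
  · intro h
    have : (1 : MvPolynomial (S × Fin 2) ℂ) ∈ zeroIdeal V := h ▸ trivial
    simpa using this Q0 hQ0
  · intro f g hfg
    have hz (p : MvPolynomial (S × Fin 2) ℂ) : ZClosed {Q | eval (flatten Q) p = 0} :=
      ⟨{p}, by simp⟩
    refine hirr _ _ (hz f) (hz g) fun Q hQ => ?_
    have := hfg Q hQ
    rwa [map_mul, mul_eq_zero] at this

theorem natCast_le_trdeg_of_strictMono {S : Type} [Finite S] {k : ℕ}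
    (c : Fin (k + 1) → Set (S → ℂ × ℂ)) (hirr : ∀ i, ZIrred (c i)) (hc : StrictMono c)
    (i : Fin (k + 1)) :
    ((i : ℕ) : Cardinal) ≤ Algebra.trdeg ℂ (MvPolynomial (S × Fin 2) ℂ ⧸ zeroIdeal (c i)) := by
  induction i using Fin.induction with
  | zero => simp
  | succ i ih =>
    have hlt := hc i.castSucc_lt_succ
    have h1 := (hirr i.castSucc).isPrime_zeroIdeal
    have h2 := (hirr i.succ).isPrime_zeroIdeal
    have hle := zeroIdeal_anti hlt.le
    have hlt' := trdeg_lt_of_surjective_of_not_injective (Ideal.Quotient.factorₐ ℂ hle)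
      (Ideal.Quotient.factor_surjective hle) (fun hinj => by
        refine hlt.not_ge ((hirr i.castSucc).1.subset_of_zeroIdeal_le fun f hf => ?_)
        rw [← Ideal.Quotient.eq_zero_iff_mem] at hf ⊢
        apply hinj
        rw [map_zero]
        exact hf)
    have := Order.succ_le_of_lt (ih.trans_lt hlt')
    rw [Cardinal.succ_natCast] at this
    simpa using this

theorem ZIrred.zDimLE_of_tangent {S ι : Type} [Fintype S] [Fintype ι] {V : Set (S → ℂ × ℂ)}
    (hV : ZIrred V) {Q : S → ℂ × ℂ} (hQ : Q ∈ V) (F : ι → MvPolynomial (S × Fin 2) ℂ)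
    (hF : ∀ i, F i ∈ zeroIdeal V) {n : ℕ} (φ : Fin n → S × Fin 2 → ℂ)
    (h : ∀ u : S × Fin 2 → ℂ, (∀ i, ∑ s, eval (flatten Q) (pderiv s (F i)) * u s = 0) →
      (∀ j, ∑ s, φ j s * u s = 0) → u = 0) :
    ZDimLE V n := by
  intro k c hirr hsub hc
  have := hV.isPrime_zeroIdeal
  have h1 := natCast_le_trdeg_of_strictMono c hirr hc (Fin.last k)
  have hle := zeroIdeal_anti (hsub (Fin.last k))
  have h2 := trdeg_le_of_surjective (Ideal.Quotient.factorₐ ℂ hle)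
    (Ideal.Quotient.factor_surjective hle)
  have h3 := trdeg_quotient_le_of_tangent (zeroIdeal V) (flatten Q) (fun f hf => hf Q hQ) F hF φ h
  have h4 := (h1.trans h2).trans h3
  simpa using h4

/-- Incidence between the point `p` and the non-vertical line `y = l.1 * x - l.2`. The relation is
symmetric, which makes point-line duality the swap of its two arguments. -/
def Inc (p l : ℝ × ℝ) : Prop := p.2 + l.2 = p.1 * l.1

theorem Inc.symm {p l : ℝ × ℝ} (h : Inc p l) : Inc l p := by
  unfold Inc at *; linarith

theorem inc_comm {p l : ℝ × ℝ} : Inc p l ↔ Inc l p := ⟨Inc.symm, Inc.symm⟩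

theorem Inc.fst_ne {p q l : ℝ × ℝ} (hp : Inc p l) (hq : Inc q l) (h : p ≠ q) : p.1 ≠ q.1 := by
  intro h1
  refine h (Prod.ext h1 ?_)
  unfold Inc at hp hq
  rw [h1] at hp
  linarith

theorem Inc.eq_of_ne {p q l k : ℝ × ℝ} (hpl : Inc p l) (hql : Inc q l) (hpk : Inc p k)
    (hqk : Inc q k) (h : p ≠ q) : l = k := by
  have h1 := hpl.fst_ne hql h
  unfold Inc at *
  have h2 : (p.1 - q.1) * (l.1 - k.1) = 0 := by linarith
  have h3 : l.1 = k.1 := by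
    rcases mul_eq_zero.1 h2 with h | h
    · exact absurd (sub_eq_zero.1 h) h1
    · exact sub_eq_zero.1 h
  refine Prod.ext h3 ?_
  rw [h3] at hpl
  linarith

/-- `(u, w)` is an infinitesimal motion of the configuration `(A, B)`: moving the points of `A` with
velocity `u` and the lines of `B` with velocity `w` preserves incidences to first order. -/
def IsMotion (A B : Finset (ℝ × ℝ)) (u w : ℝ × ℝ → ℝ × ℝ) : Prop :=
  ∀ p ∈ A, ∀ l ∈ B, Inc p l → (u p).2 + (w l).2 = (u p).1 * l.1 + p.1 * (w l).1

/-- The space of infinitesimal motions of `(A, B)` has dimension at most `R`. -/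
def RigidLE (A B : Finset (ℝ × ℝ)) (R : ℕ) : Prop :=
  ∀ u w : Fin (R + 1) → ℝ × ℝ → ℝ × ℝ, (∀ j, IsMotion A B (u j) (w j)) →
    ∃ c : Fin (R + 1) → ℝ, c ≠ 0 ∧ (∀ p ∈ A, ∑ j, c j • u j p = 0) ∧ ∀ l ∈ B, ∑ j, c j • w j l = 0

/-- The polynomial expressing that the points `t.1`, `t.2.1`, `t.2.2` are collinear. -/
def collinearPoly {S : Type} (a b c : S) : MvPolynomial (S × Fin 2) ℂ :=
  (X (b, 0) - X (a, 0)) * (X (c, 1) - X (a, 1)) - (X (c, 0) - X (a, 0)) * (X (b, 1) - X (a, 1))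

theorem eval_collinearPoly_eq_zero {S : Type} {Q : S → ℂ × ℂ} {a b c : S}
    (h : Collinear ℂ (Q '' {a, b, c})) : eval (flatten Q) (collinearPoly a b c) = 0 := by
  have ha : Q a ∈ Q '' {a, b, c} := ⟨a, by simp, rfl⟩
  obtain ⟨v, hv⟩ := (collinear_iff_of_mem ha).1 h
  obtain ⟨r, hr⟩ := hv (Q b) ⟨b, by simp, rfl⟩
  obtain ⟨s, hs⟩ := hv (Q c) ⟨c, by simp, rfl⟩
  simp only [collinearPoly, map_sub, map_mul, eval_X, flatten, hr, hs]
  simp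
  ring

theorem sum_pderiv_collinearPoly {S : Type} [Fintype S] (z u : S × Fin 2 → ℂ) (a b c : S) :
    ∑ s, eval z (pderiv s (collinearPoly a b c)) * u s =
      (u (b, 0) - u (a, 0)) * (z (c, 1) - z (a, 1)) + (z (b, 0) - z (a, 0)) * (u (c, 1) - u (a, 1))
      - ((u (c, 0) - u (a, 0)) * (z (b, 1) - z (a, 1))
        + (z (c, 0) - z (a, 0)) * (u (b, 1) - u (a, 1))) := by
  classical
  have hX (i : S × Fin 2) : ∑ s, eval z (pderiv s (X i)) * u s = u i := by
    rw [Finset.sum_eq_single i]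
    · simp
    · intro j _ hj; simp [pderiv_X_of_ne hj.symm]
    · simp
  have hsub (f g : MvPolynomial (S × Fin 2) ℂ) : ∑ s, eval z (pderiv s (f - g)) * u s =
      ∑ s, eval z (pderiv s f) * u s - ∑ s, eval z (pderiv s g) * u s := by
    simp only [map_sub, sub_mul, Finset.sum_sub_distrib]
  have hmul (f g : MvPolynomial (S × Fin 2) ℂ) : ∑ s, eval z (pderiv s (f * g)) * u s =
      (∑ s, eval z (pderiv s f) * u s) * eval z g +
        eval z f * ∑ s, eval z (pderiv s g) * u s := by
    simp only [pderiv_mul, map_add, map_mul, add_mul, Finset.sum_add_distrib, Finset.sum_mul,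
      Finset.mul_sum]
    congr 1 <;> exact Finset.sum_congr rfl fun s _ => by ring
  rw [collinearPoly]
  simp only [hsub, hmul, hX]
  simp only [map_sub, eval_X]

theorem collinear_emb_image {l : Set (ℝ × ℝ)} (hl : IsLine l) {s : Set (ℝ × ℝ)} (hs : s ⊆ l) :
    Collinear ℂ (emb '' s) := by
  rcases s.eq_empty_or_nonempty with rfl | ⟨q, hq⟩
  · simp [collinear_empty]
  obtain ⟨a, b, c, hab, rfl⟩ := hl
  rw [collinear_iff_of_mem (Set.mem_image_of_mem emb hq)]
  refine ⟨(-(b : ℂ), (a : ℂ)), ?_⟩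
  rintro _ ⟨p, hp, rfl⟩
  have h1 : a * p.1 + b * p.2 = c := hs hp
  have h2 : a * q.1 + b * q.2 = c := hs hq
  have h0 : a ^ 2 + b ^ 2 ≠ 0 := by
    intro h
    apply hab
    have ha : a = 0 := by nlinarith [sq_nonneg a, sq_nonneg b]
    have hb : b = 0 := by nlinarith [sq_nonneg a, sq_nonneg b]
    rw [ha, hb]
  refine ⟨((a * (p.2 - q.2) - b * (p.1 - q.1)) / (a ^ 2 + b ^ 2) : ℝ), ?_⟩
  have e1 : p.1 = (a * (p.2 - q.2) - b * (p.1 - q.1)) / (a ^ 2 + b ^ 2) * (-b) + q.1 := by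
    field_simp
    linear_combination a * (h1 - h2)
  have e2 : p.2 = (a * (p.2 - q.2) - b * (p.1 - q.1)) / (a ^ 2 + b ^ 2) * a + q.2 := by
    field_simp
    linear_combination b * (h1 - h2)
  refine Prod.ext ?_ ?_
  · simpa [emb] using congrArg (Complex.ofReal) e1
  · simpa [emb] using congrArg (Complex.ofReal) e2

theorem exists_isMotion {A B : Finset (ℝ × ℝ)} {u : ℝ × ℝ → ℝ × ℝ}
    (h : ∀ p ∈ A, ∀ q ∈ A, ∀ r ∈ A, p ≠ q → p ≠ r → q ≠ r →
      (∃ l ∈ B, Inc p l ∧ Inc q l ∧ Inc r l) →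
      ((u q).1 - (u p).1) * (r.2 - p.2) + (q.1 - p.1) * ((u r).2 - (u p).2)
      - (((u r).1 - (u p).1) * (q.2 - p.2) + (r.1 - p.1) * ((u q).2 - (u p).2)) = 0) :
    ∃ w, IsMotion A B u w := by
  have key : ∀ l : ℝ × ℝ, ∃ w : ℝ × ℝ, l ∈ B → ∀ p ∈ A, Inc p l →
      (u p).2 + w.2 = (u p).1 * l.1 + p.1 * w.1 := by
    intro l
    by_cases hl : l ∈ B
    swap
    · exact ⟨0, fun h => absurd h hl⟩
    by_cases h1 : ∃ p ∈ A, Inc p l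
    swap
    · push Not at h1
      exact ⟨0, fun _ p hp hi => absurd hi (h1 p hp)⟩
    obtain ⟨p, hp, hpl⟩ := h1
    by_cases h2 : ∃ q ∈ A, Inc q l ∧ p ≠ q
    swap
    · push Not at h2
      refine ⟨(0, (u p).1 * l.1 - (u p).2), fun _ r hr hrl => ?_⟩
      rw [← h2 r hr hrl]
      ring
    obtain ⟨q, hq, hql, hpq⟩ := h2
    have hx : q.1 - p.1 ≠ 0 := sub_ne_zero.2 (hql.fst_ne hpl hpq.symm)
    set s := (((u q).2 - (u q).1 * l.1) - ((u p).2 - (u p).1 * l.1)) / (q.1 - p.1) with hs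
    have hs' : s * (q.1 - p.1) = ((u q).2 - (u q).1 * l.1) - ((u p).2 - (u p).1 * l.1) := by
      rw [hs, div_mul_cancel₀ _ hx]
    refine ⟨(s, p.1 * s - ((u p).2 - (u p).1 * l.1)), fun _ r hr hrl => ?_⟩
    rcases eq_or_ne p r with rfl | hpr
    · simp only
      ring
    rcases eq_or_ne q r with rfl | hqr
    · simp only
      linear_combination -hs'
    have h3 := h p hp q hq r hr hpq hpr hqr ⟨l, hl, hpl, hql, hrl⟩
    unfold Inc at hpl hql hrl
    have e1 : r.2 - p.2 = (r.1 - p.1) * l.1 := by linear_combination hrl - hpl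
    have e2 : q.2 - p.2 = (q.1 - p.1) * l.1 := by linear_combination hql - hpl
    rw [e1, e2] at h3
    simp only
    apply mul_left_cancel₀ hx
    linear_combination h3 - (r.1 - p.1) * hs'
  choose w hw using key
  exact ⟨w, fun p hp l hl => hw l hl p hp⟩

theorem exists_injOn_linearMap {V : Type*} [AddCommGroup V] [Module ℝ V] [FiniteDimensional ℝ V]
    (T : Submodule ℝ V) {R : ℕ} (h : Module.finrank ℝ T ≤ R) :
    ∃ φ : V →ₗ[ℝ] (Fin R → ℝ), ∀ v ∈ T, φ v = 0 → v = 0 := by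
  let b := Module.finBasis ℝ T
  let f : T →ₗ[ℝ] (Fin R → ℝ) := LinearMap.pi fun j =>
    if hj : (j : ℕ) < Module.finrank ℝ T then b.coord ⟨j, hj⟩ else 0
  obtain ⟨φ, hφ⟩ := f.exists_extend
  refine ⟨φ, fun v hv h0 => ?_⟩
  have h1 : f ⟨v, hv⟩ = 0 := by rw [← hφ]; exact h0
  have h2 : (⟨v, hv⟩ : T) = 0 := by
    refine b.ext_elem fun i => ?_
    have := congrFun h1 ⟨i, i.2.trans_le h⟩
    simpa [f] using this
  exact congrArg Subtype.val h2

theorem RigidLE.configRigid {A B : Finset (ℝ × ℝ)} {R : ℕ} (h : RigidLE A B R)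
    {L : Set (Set (ℝ × ℝ))} (hL : ∀ l ∈ L, IsLine l) (hB : ∀ l ∈ B, {p | Inc p l} ∈ L) :
    ConfigRigid (A : Set (ℝ × ℝ)) L R := by
  classical
  let S := ↥(A : Set (ℝ × ℝ))
  let ι := {t : S × S × S // t.1 ≠ t.2.1 ∧ t.1 ≠ t.2.2 ∧ t.2.1 ≠ t.2.2 ∧
    ∃ l ∈ B, Inc t.1 l ∧ Inc t.2.1 l ∧ Inc t.2.2 l}
  let Q : S → ℂ × ℂ := fun p => emb p
  let F : ι → MvPolynomial (S × Fin 2) ℂ := fun t => collinearPoly t.1.1 t.1.2.1 t.1.2.2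
  refine ⟨?_, fun V hV hQV => ?_⟩
  · rintro t ⟨-, l, hl, ht⟩
    have : (fun p : S => emb p) '' t = emb '' (Subtype.val '' t) := by
      rw [Set.image_image]
    rw [this]
    refine collinear_emb_image (hL l hl) ?_
    rintro _ ⟨p, hp, rfl⟩
    exact ht p hp
  let T : Submodule ℝ (S × Fin 2 → ℝ) :=
    { carrier := {u | ∀ t : ι, ∀ a b c : S, (a, b, c) = t.1 →
        (u (b, 0) - u (a, 0)) * (c.1.2 - a.1.2) + (b.1.1 - a.1.1) * (u (c, 1) - u (a, 1))
        - ((u (c, 0) - u (a, 0)) * (b.1.2 - a.1.2) + (c.1.1 - a.1.1) * (u (b, 1) - u (a, 1))) = 0}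
      add_mem' := fun {u v} hu hv t a b c ht => by
        have h1 := hu t a b c ht
        have h2 := hv t a b c ht
        simp only [Pi.add_apply]
        linear_combination h1 + h2
      zero_mem' := fun t a b c ht => by simp
      smul_mem' := fun r u hu t a b c ht => by
        have h1 := hu t a b c ht
        simp only [Pi.smul_apply, smul_eq_mul]
        linear_combination r * h1 }
  have hfin : Module.finrank ℝ T ≤ R := by
    by_contra hlt
    push Not at hlt
    obtain ⟨v, hv⟩ := exists_linearIndependent_of_le_finrank (R := ℝ) (M := T) (n := R + 1) hlt
    let u : Fin (R + 1) → ℝ × ℝ → ℝ × ℝ := fun j p =>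
      if hp : p ∈ A then ((v j).1 (⟨p, hp⟩, 0), (v j).1 (⟨p, hp⟩, 1)) else 0
    have hw : ∀ j, ∃ w, IsMotion A B (u j) w := by
      intro j
      refine exists_isMotion fun p hp q hq r hr hpq hpr hqr hl => ?_
      have := (v j).2 ⟨(⟨p, hp⟩, ⟨q, hq⟩, ⟨r, hr⟩), fun h => hpq (congrArg Subtype.val h),
        fun h => hpr (congrArg Subtype.val h), fun h => hqr (congrArg Subtype.val h), hl⟩ _ _ _ rfl
      simpa [u, hp, hq, hr] using this
    choose w hw using hw
    obtain ⟨c, hc, hcA, -⟩ := h u w hw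
    apply hc
    refine funext fun j => Fintype.linearIndependent_iff.1 hv c ?_ j
    ext ⟨⟨p, hp⟩, i⟩
    have hp' : p ∈ A := hp
    have := hcA p hp'
    rw [Prod.ext_iff, Prod.fst_sum, Prod.snd_sum] at this
    simp only [u, hp', dif_pos, Prod.smul_fst, Prod.smul_snd, smul_eq_mul, Prod.fst_zero,
      Prod.snd_zero] at this
    fin_cases i
    · simpa using this.1
    · simpa using this.2
  obtain ⟨φ, hφ⟩ := exists_injOn_linearMap T hfin
  let φc : Fin R → S × Fin 2 → ℂ := fun j s => (φ (Pi.single s 1) j : ℂ)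
  have hφsum : ∀ (u : S × Fin 2 → ℝ) j, ∑ s, φ (Pi.single s 1) j * u s = φ u j := by
    intro u j
    conv_rhs => rw [pi_eq_sum_univ' u]
    simp [mul_comm]
  refine hV.1.zDimLE_of_tangent hQV F (fun t Q' hQ' => ?_) φc fun u hu hφu => ?_
  · apply eval_collinearPoly_eq_zero
    refine hV.2.1 hQ' _ ⟨?_, ?_⟩
    · rw [Set.ncard_eq_toFinset_card']
      simp only [Set.toFinset_insert, Set.toFinset_singleton]
      exact Finset.card_eq_three.2 ⟨_, _, _, t.2.1, t.2.2.1, t.2.2.2.1, rfl⟩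
    · obtain ⟨l, hl, h1, h2, h3⟩ := t.2.2.2.2
      refine ⟨_, hB l hl, ?_⟩
      rintro p (rfl | rfl | rfl)
      exacts [h1, h2, h3]
  · have hre : (fun s => (u s).re) ∈ T := by
      rintro t a b c ht
      have := hu t
      simp only [F, ← ht, sum_pderiv_collinearPoly] at this
      have := congrArg Complex.re this
      simpa [flatten, Q, emb] using this
    have him : (fun s => (u s).im) ∈ T := by
      rintro t a b c ht
      have := hu t
      simp only [F, ← ht, sum_pderiv_collinearPoly] at this
      have := congrArg Complex.im this
      simpa [flatten, Q, emb] using this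
    have hre0 := hφ _ hre (funext fun j => by
      have := congrArg Complex.re (hφu j)
      rw [← hφsum]
      refine Eq.trans ?_ this
      simp only [φc, Complex.re_sum, Complex.re_ofReal_mul]
      congr!)
    have him0 := hφ _ him (funext fun j => by
      have := congrArg Complex.im (hφu j)
      rw [← hφsum]
      refine Eq.trans ?_ this
      simp only [φc, Complex.im_sum, Complex.im_ofReal_mul]
      congr!)
    funext s
    exact Complex.ext (congrFun hre0 s) (congrFun him0 s)

theorem finrank_mul_sq_le_of_rows {V E : Type*} [Fintype V] [Fintype E] (b : E → V → Fin 2 → ℝ)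
    (K : ℝ) (hK : 0 ≤ K) (hnorm : ∀ i, ∑ q, ∑ α, b i q α ^ 2 ≤ 1)
    (hlow : ∀ p (v : Fin 2 → ℝ), K * ∑ α, v α ^ 2 ≤ ∑ i, (∑ α, b i p α * v α) ^ 2)
    (hpair : ∀ p q, p ≠ q → ∀ i i', i ≠ i' → b i p = 0 ∨ b i q = 0 ∨ b i' p = 0 ∨ b i' q = 0)
    (W : Submodule ℝ (EuclideanSpace ℝ (V × Fin 2)))
    (hW : ∀ v ∈ W, ∀ i, ∑ q, ∑ α, b i q α * v (q, α) = 0) :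
    Module.finrank ℝ W * K ^ 2 ≤ Fintype.card E := by
  classical
  set D := Module.finrank ℝ W
  let e := stdOrthonormalBasis ℝ W
  let x : Fin D → V → Fin 2 → ℝ := fun j p α => (e j : EuclideanSpace ℝ (V × Fin 2)) (p, α)
  let h : V → Fin 2 → EuclideanSpace ℝ (V × Fin 2) := fun p α =>
    WithLp.toLp 2 fun qβ => if qβ.1 = p then 0 else ∑ i, b i p α * b i qβ.1 qβ.2
  let H : Fin D → V → Fin 2 → ℝ := fun j p α => ∑ q, ∑ β, h p α (q, β) * x j q β
  have horth : Orthonormal ℝ (fun j => (e j : EuclideanSpace ℝ (V × Fin 2))) :=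
    e.orthonormal.comp_linearIsometry W.subtypeₗᵢ
  have hx1 : ∀ j, ∑ p, ∑ α, x j p α ^ 2 = 1 := by
    intro j
    have := horth.1 j
    have h2 : ‖(e j : EuclideanSpace ℝ (V × Fin 2))‖ ^ 2 = 1 := by rw [this]; norm_num
    rw [EuclideanSpace.real_norm_sq_eq, Fintype.sum_prod_type] at h2
    exact h2
  have hBessel : ∀ p α, ∑ j, H j p α ^ 2 ≤ ∑ q, ∑ β, h p α (q, β) ^ 2 := by
    intro p α
    have := horth.sum_inner_products_le (h p α) (s := Finset.univ)
    rw [EuclideanSpace.real_norm_sq_eq, Fintype.sum_prod_type] at this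
    refine le_trans (le_of_eq ?_) this
    refine Finset.sum_congr rfl fun j _ => ?_
    rw [Real.norm_eq_abs, sq_abs, PiLp.inner_apply, Fintype.sum_prod_type]
    simp [H, x]
  have hpoint : ∀ j p, K ^ 2 * ∑ α, x j p α ^ 2 ≤ ∑ α, H j p α ^ 2 := by
    intro j p
    have h1 : ∑ i, (∑ α, b i p α * x j p α) ^ 2 = - ∑ α, x j p α * H j p α := by
      have h2 : ∀ i, ∑ α, b i p α * x j p α =
          - ∑ q, ∑ β, (if q = p then 0 else b i q β) * x j q β := by
        intro i
        have h3 : ∑ q, ∑ α, b i q α * x j q α = 0 := hW _ (e j).2 i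
        rw [← Finset.add_sum_erase _ _ (Finset.mem_univ p)] at h3
        have h4 : ∑ q, ∑ β, (if q = p then 0 else b i q β) * x j q β =
            ∑ q ∈ Finset.univ.erase p, ∑ β, b i q β * x j q β := by
          rw [← Finset.add_sum_erase _ (fun q => ∑ β, (if q = p then 0 else b i q β) * x j q β)
            (Finset.mem_univ p)]
          simp only [if_true, zero_mul, Finset.sum_const_zero, zero_add]
          refine Finset.sum_congr rfl fun q hq => ?_
          simp only [if_neg (Finset.ne_of_mem_erase hq)]
        rw [eq_neg_iff_add_eq_zero, h4, h3]
      calc ∑ i, (∑ α, b i p α * x j p α) ^ 2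
          = ∑ i, (∑ α, b i p α * x j p α) *
              (- ∑ q, ∑ β, (if q = p then 0 else b i q β) * x j q β) :=
            Finset.sum_congr rfl fun i _ => by rw [← h2 i, sq]
        _ = - ∑ i, ∑ α, ∑ q, ∑ β, x j p α *
              ((if q = p then 0 else b i p α * b i q β) * x j q β) := by
            rw [← Finset.sum_neg_distrib]
            refine Finset.sum_congr rfl fun i _ => ?_
            rw [mul_neg, Finset.sum_mul]
            congr 1
            refine Finset.sum_congr rfl fun α _ => ?_
            rw [Finset.mul_sum]
            refine Finset.sum_congr rfl fun q _ => ?_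
            rw [Finset.mul_sum]
            refine Finset.sum_congr rfl fun β _ => ?_
            split_ifs <;> ring
        _ = - ∑ α, x j p α * H j p α := by
            congr 1
            rw [Finset.sum_comm]
            refine Finset.sum_congr rfl fun α _ => ?_
            rw [Finset.sum_comm, Finset.mul_sum]
            refine Finset.sum_congr rfl fun q _ => ?_
            rw [Finset.sum_comm, Finset.mul_sum]
            refine Finset.sum_congr rfl fun β _ => ?_
            rw [← Finset.mul_sum, ← Finset.sum_mul]
            simp only [h]
            split_ifs <;> simp
    have h2 := hlow p (x j p)
    rw [h1] at h2
    set X := ∑ α, x j p α ^ 2 with hX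
    set Y := ∑ α, H j p α ^ 2 with hY
    have hX0 : 0 ≤ X := Finset.sum_nonneg fun _ _ => sq_nonneg _
    have hY0 : 0 ≤ Y := Finset.sum_nonneg fun _ _ => sq_nonneg _
    have hCS : (∑ α, x j p α * H j p α) ^ 2 ≤ X * Y := Finset.sum_mul_sq_le_sq_mul_sq _ _ _
    rcases hX0.eq_or_lt with h0 | h0
    · rw [← h0, mul_zero]; exact hY0
    · have h3 : (K * X) ^ 2 ≤ X * Y := by
        refine le_trans ?_ hCS
        rw [← neg_sq (∑ α, x j p α * H j p α)]
        exact pow_le_pow_left₀ (by positivity) h2 2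
      refine le_of_mul_le_mul_left ?_ h0
      calc X * (K ^ 2 * X) = (K * X) ^ 2 := by ring
        _ ≤ X * Y := h3
  have hh : ∀ p α q β, h p α (q, β) ^ 2 ≤ ∑ i, b i p α ^ 2 * b i q β ^ 2 := by
    intro p α q β
    simp only [h]
    split_ifs with hqp
    · rw [zero_pow two_ne_zero]; positivity
    · by_cases hex : ∃ i, b i p ≠ 0 ∧ b i q ≠ 0
      · obtain ⟨i, hip, hiq⟩ := hex
        have h0 : ∀ i' ≠ i, b i' p α * b i' q β = 0 := by
          intro i' hi'
          rcases hpair p q (Ne.symm hqp) i i' hi'.symm with h | h | h | h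
          · exact absurd h hip
          · exact absurd h hiq
          · simp [h]
          · simp [h]
        rw [Finset.sum_eq_single i (fun i' _ h => h0 i' h) (by simp), mul_pow]
        exact Finset.single_le_sum (f := fun i => b i p α ^ 2 * b i q β ^ 2)
          (fun _ _ => by positivity) (Finset.mem_univ i)
      · push Not at hex
        rw [Finset.sum_eq_zero fun i _ => ?_]
        · rw [zero_pow two_ne_zero]; positivity
        · by_cases hip : b i p = 0
          · simp [hip]
          · simp [hex i hip]
  calc (D : ℝ) * K ^ 2 = ∑ j : Fin D, K ^ 2 * ∑ p, ∑ α, x j p α ^ 2 := by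
        simp only [hx1, mul_one, Finset.sum_const, Finset.card_univ, Fintype.card_fin, nsmul_eq_mul]
    _ = ∑ j : Fin D, ∑ p, K ^ 2 * ∑ α, x j p α ^ 2 := by simp only [Finset.mul_sum]
    _ ≤ ∑ j : Fin D, ∑ p, ∑ α, H j p α ^ 2 :=
        Finset.sum_le_sum fun j _ => Finset.sum_le_sum fun p _ => hpoint j p
    _ = ∑ p, ∑ α, ∑ j : Fin D, H j p α ^ 2 := by
        rw [Finset.sum_comm]
        exact Finset.sum_congr rfl fun p _ => Finset.sum_comm
    _ ≤ ∑ p, ∑ α, ∑ q, ∑ β, ∑ i, b i p α ^ 2 * b i q β ^ 2 :=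
        Finset.sum_le_sum fun p _ => Finset.sum_le_sum fun α _ => (hBessel p α).trans
          (Finset.sum_le_sum fun q _ => Finset.sum_le_sum fun β _ => hh p α q β)
    _ = ∑ i, (∑ p, ∑ α, b i p α ^ 2) * ∑ q, ∑ β, b i q β ^ 2 := by
        have hc : ∀ f : V × Fin 2 → V × Fin 2 → E → ℝ, ∑ p, ∑ α, ∑ q, ∑ β, ∑ i, f (p, α) (q, β) i =
            ∑ i, ∑ p, ∑ α, ∑ q, ∑ β, f (p, α) (q, β) i := by
          intro f
          have h1 : ∑ s, ∑ t, ∑ i, f s t i = ∑ i, ∑ s, ∑ t, f s t i :=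
            (Finset.sum_congr rfl fun s _ => Finset.sum_comm).trans Finset.sum_comm
          simpa only [Fintype.sum_prod_type] using h1
        rw [hc fun s t i => b i s.1 s.2 ^ 2 * b i t.1 t.2 ^ 2]
        simp only [← Finset.mul_sum, ← Finset.sum_mul]
    _ ≤ ∑ i : E, 1 := by
        refine Finset.sum_le_sum fun i _ => ?_
        have h0 : 0 ≤ ∑ p, ∑ α, b i p α ^ 2 := by positivity
        exact mul_le_one₀ (hnorm i) h0 (hnorm i)
    _ = Fintype.card E := by simp

theorem det_mul_det_sq_le (S : Matrix (Fin 2) (Fin 2) ℝ) (x y : Fin 2 → ℝ) :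
    S.det ^ 2 * (x 0 * y 1 - x 1 * y 0) ^ 2 ≤
      (∑ α, (S.mulVec x) α ^ 2) * ∑ α, (S.mulVec y) α ^ 2 := by
  simp only [Matrix.det_fin_two, Matrix.mulVec, dotProduct, Fin.sum_univ_two]
  nlinarith [sq_nonneg ((S 0 0 * x 0 + S 0 1 * x 1) * (S 0 0 * y 0 + S 0 1 * y 1) +
    (S 1 0 * x 0 + S 1 1 * x 1) * (S 1 0 * y 0 + S 1 1 * y 1))]

theorem exists_forall_le_sum_log {E : Type*} (s : Finset E) (hs : 2 ≤ s.card)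
    (g : E → Fin 2 → ℝ)
    (hdet : ∀ i ∈ s, ∀ i' ∈ s, i ≠ i' → g i 0 * g i' 1 - g i 1 * g i' 0 ≠ 0) :
    ∃ C : ℝ, ∀ S : Matrix (Fin 2) (Fin 2) ℝ, S.det ≠ 0 →
      s.card / 2 * Real.log (S.det ^ 2) + C ≤ ∑ i ∈ s, Real.log (∑ α, (S.mulVec (g i)) α ^ 2) := by
  classical
  let c : E → E → ℝ := fun i i' => Real.log ((g i 0 * g i' 1 - g i 1 * g i' 0) ^ 2)
  refine ⟨(∑ i ∈ s, ∑ i' ∈ s.erase i, c i i') / (2 * (s.card - 1)), fun S hS => ?_⟩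
  set a : E → ℝ := fun i => Real.log (∑ α, (S.mulVec (g i)) α ^ 2) with ha
  set L := Real.log (S.det ^ 2) with hL
  have hr : (2 : ℝ) ≤ s.card := by exact_mod_cast hs
  have key : ∀ i ∈ s, ∀ i' ∈ s.erase i, L + c i i' ≤ a i + a i' := by
    intro i hi i' hi'
    have hne := hdet i hi i' (Finset.mem_of_mem_erase hi') (Finset.ne_of_mem_erase hi').symm
    have h1 := det_mul_det_sq_le S (g i) (g i')
    have h0 : 0 < S.det ^ 2 * (g i 0 * g i' 1 - g i 1 * g i' 0) ^ 2 := by positivity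
    have h2 := Real.log_le_log h0 h1
    have hp := h0.trans_le h1
    have hx : (∑ α, (S.mulVec (g i)) α ^ 2) ≠ 0 := fun h => by
      simp only [h, zero_mul, lt_irrefl] at hp
    have hy : (∑ α, (S.mulVec (g i')) α ^ 2) ≠ 0 := fun h => by
      simp only [h, mul_zero, lt_irrefl] at hp
    rw [Real.log_mul (by positivity) (by positivity), Real.log_mul hx hy] at h2
    exact h2
  have h1 := Finset.sum_le_sum fun i hi => Finset.sum_le_sum (key i hi)
  have h2 : ∑ i ∈ s, ∑ i' ∈ s.erase i, (L + c i i') =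
      s.card * (s.card - 1) * L + ∑ i ∈ s, ∑ i' ∈ s.erase i, c i i' := by
    simp only [Finset.sum_add_distrib]
    congr 1
    rw [Finset.sum_congr rfl fun i hi => show _ = ((s.card : ℝ) - 1) * L by
      rw [Finset.sum_const, Finset.card_erase_of_mem hi, nsmul_eq_mul,
        Nat.cast_sub (by omega), Nat.cast_one]]
    rw [Finset.sum_const, nsmul_eq_mul, mul_assoc]
  have h3 : ∑ i ∈ s, ∑ i' ∈ s.erase i, (a i + a i') = 2 * (s.card - 1) * ∑ i ∈ s, a i := by
    rw [Finset.sum_congr rfl fun i hi => show _ = ((s.card : ℝ) - 1) * a i + (∑ j ∈ s, a j - a i) by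
      rw [Finset.sum_add_distrib, Finset.sum_erase_eq_sub hi, Finset.sum_erase_eq_sub hi,
        Finset.sum_const, nsmul_eq_mul]; ring]
    rw [Finset.sum_add_distrib, Finset.sum_sub_distrib, ← Finset.mul_sum, Finset.sum_const,
      nsmul_eq_mul]
    ring
  rw [h2, h3] at h1
  have h4 : (0 : ℝ) < 2 * (s.card - 1) := by linarith
  rw [← sub_nonneg]
  have h5 : 0 ≤ (2 * ((s.card : ℝ) - 1) * ∑ i ∈ s, a i - (s.card * (s.card - 1) * L +
      ∑ i ∈ s, ∑ i' ∈ s.erase i, c i i')) / (2 * (s.card - 1)) :=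
    div_nonneg (sub_nonneg.2 h1) h4.le
  have h6 : (s.card : ℝ) - 1 ≠ 0 := by linarith
  convert h5 using 1
  field_simp

theorem exists_scaling {V E : Type*} [Fintype V] [Fintype E] [DecidableEq V]
    (g : E → V → Fin 2 → ℝ) (T : E → Finset V) (hT : ∀ i, (T i).card = 3)
    (hdet : ∀ q i i', i ≠ i' → q ∈ T i → q ∈ T i' → g i q 0 * g i' q 1 - g i q 1 * g i' q 0 ≠ 0)
    (r : ℕ) (hr : 2 ≤ r) (hdeg : ∀ p, r ≤ (Finset.univ.filter fun i => p ∈ T i).card) :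
    ∃ (S : V → Matrix (Fin 2) (Fin 2) ℝ) (c : E → ℝ), (∀ p, (S p).det ≠ 0) ∧ (∀ i, c i ≠ 0) ∧
      (∀ i, ∑ q, ∑ α, (c i * (S q).mulVec (g i q) α) ^ 2 ≤ 1) ∧
      ∀ p (v : Fin 2 → ℝ), (r / 20 : ℝ) * ∑ α, v α ^ 2 ≤
        ∑ i, (∑ α, c i * (S p).mulVec (g i p) α * v α) ^ 2 := by
  let s : V → Finset E := fun p => Finset.univ.filter fun i => p ∈ T i
  have hmem : ∀ {p i}, i ∈ s p ↔ p ∈ T i := by simp [s]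
  let N : (V → Matrix (Fin 2) (Fin 2) ℝ) → E → ℝ := fun S i => ∑ q, ∑ α, (S q).mulVec (g i q) α ^ 2
  let f : (V → Matrix (Fin 2) (Fin 2) ℝ) → ℝ := fun S =>
    ∑ i, Real.log (N S i) - ∑ p, (s p).card / 6 * Real.log ((S p).det ^ 2)
  have hcard : ∀ p, 2 ≤ (s p).card := fun p => hr.trans (hdeg p)
  have hpos : ∀ S : V → Matrix (Fin 2) (Fin 2) ℝ, (∀ p, (S p).det ≠ 0) → ∀ i, ∀ q ∈ T i,
      0 < ∑ α, (S q).mulVec (g i q) α ^ 2 := by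
    intro S hS i q hq
    obtain ⟨i', hi', hne⟩ := Finset.exists_mem_ne (hcard q) i
    have h1 := det_mul_det_sq_le (S q) (g i q) (g i' q)
    have h2 := hdet q i i' hne.symm hq (hmem.1 hi')
    have h3 := hS q
    have h0 : 0 < (S q).det ^ 2 * (g i q 0 * g i' q 1 - g i q 1 * g i' q 0) ^ 2 := by positivity
    have h4 : 0 ≤ ∑ α, (S q).mulVec (g i q) α ^ 2 := by positivity
    refine h4.lt_of_ne' fun h => ?_
    rw [h, zero_mul] at h1
    exact absurd h0 h1.not_gt
  have hNle : ∀ S i q, ∑ α, (S q).mulVec (g i q) α ^ 2 ≤ N S i := fun S i q =>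
    Finset.single_le_sum (f := fun q => ∑ α, (S q).mulVec (g i q) α ^ 2)
      (fun _ _ => by positivity) (Finset.mem_univ q)
  have hNpos : ∀ S : V → Matrix (Fin 2) (Fin 2) ℝ, (∀ p, (S p).det ≠ 0) → ∀ i, 0 < N S i := by
    intro S hS i
    obtain ⟨q, hq⟩ := Finset.card_pos.1 (by rw [hT i]; norm_num : 0 < (T i).card)
    exact (hpos S hS i q hq).trans_le (hNle S i q)
  have hC : ∀ p, ∃ C : ℝ, ∀ S : Matrix (Fin 2) (Fin 2) ℝ, S.det ≠ 0 →
      (s p).card / 2 * Real.log (S.det ^ 2) + C ≤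
        ∑ i ∈ s p, Real.log (∑ α, (S.mulVec (g i p)) α ^ 2) := fun p =>
    exists_forall_le_sum_log (s p) (hcard p) (fun i => g i p) fun i hi i' hi' hne =>
      hdet p i i' hne (hmem.1 hi) (hmem.1 hi')
  choose C hC using hC
  have hbdd : ∀ S : V → Matrix (Fin 2) (Fin 2) ℝ, (∀ p, (S p).det ≠ 0) → ∑ p, C p / 3 ≤ f S := by
    intro S hS
    have h1 : ∀ i, 1 / 3 * ∑ q ∈ T i, Real.log (∑ α, (S q).mulVec (g i q) α ^ 2) ≤
        Real.log (N S i) := by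
      intro i
      have h2 : ∑ q ∈ T i, Real.log (∑ α, (S q).mulVec (g i q) α ^ 2) ≤
          ∑ q ∈ T i, Real.log (N S i) := Finset.sum_le_sum fun q hq =>
        Real.log_le_log (hpos S hS i q hq) (hNle S i q)
      rw [Finset.sum_const, hT i, nsmul_eq_mul] at h2
      push_cast at h2
      linarith
    have h2 : ∑ i, ∑ q ∈ T i, Real.log (∑ α, (S q).mulVec (g i q) α ^ 2) =
        ∑ p, ∑ i ∈ s p, Real.log (∑ α, (S p).mulVec (g i p) α ^ 2) :=
      Finset.sum_comm' (by simp [s])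
    have h3 := Finset.sum_le_sum fun i (_ : i ∈ Finset.univ) => h1 i
    rw [← Finset.mul_sum, h2] at h3
    have h4 := Finset.sum_le_sum fun p (_ : p ∈ Finset.univ) => hC p (S p) (hS p)
    have h5 : ∑ p, C p / 3 = 1 / 3 * ∑ p, ((s p).card / 2 * Real.log ((S p).det ^ 2) + C p) -
        ∑ p, (s p).card / 6 * Real.log ((S p).det ^ 2) := by
      rw [Finset.mul_sum, ← Finset.sum_sub_distrib]
      exact Finset.sum_congr rfl fun p _ => by ring
    rw [h5]
    simp only [f]
    linarith
  obtain ⟨S, hS, hmin⟩ : ∃ S : V → Matrix (Fin 2) (Fin 2) ℝ, (∀ p, (S p).det ≠ 0) ∧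
      ∀ S' : V → Matrix (Fin 2) (Fin 2) ℝ, (∀ p, (S' p).det ≠ 0) → f S < f S' + 1 / 10 := by
    let F := f '' {S | ∀ p, (S p).det ≠ 0}
    have hF : F.Nonempty := ⟨_, 1, by simp, rfl⟩
    have hFb : BddBelow F := ⟨∑ p, C p / 3, by rintro _ ⟨S, hS, rfl⟩; exact hbdd S hS⟩
    obtain ⟨_, ⟨S, hS, rfl⟩, h⟩ := exists_lt_of_csInf_lt hF (lt_add_of_pos_right (sInf F)
      (by norm_num : (0 : ℝ) < 1 / 10))
    exact ⟨S, hS, fun S' hS' => h.trans_le (by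
      have := csInf_le hFb (Set.mem_image_of_mem f hS'); linarith)⟩
  have hunit : ∀ p (v : Fin 2 → ℝ), ∑ α, v α ^ 2 = 1 →
      (r / 20 : ℝ) ≤ ∑ i, (∑ α, (S p).mulVec (g i p) α * v α) ^ 2 / N S i := by
    intro p v hv
    set M : Matrix (Fin 2) (Fin 2) ℝ := 1 + Matrix.vecMulVec v v with hM
    have hMdet : M.det = 2 := by
      simp only [Fin.sum_univ_two] at hv
      simp only [hM, Matrix.det_fin_two, Matrix.add_apply, Matrix.vecMulVec_apply, Matrix.one_apply]
      simp
      linarith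
    have hMv : ∀ x : Fin 2 → ℝ, ∑ α, M.mulVec x α ^ 2 =
        ∑ α, x α ^ 2 + 3 * (∑ α, x α * v α) ^ 2 := by
      intro x
      simp only [Fin.sum_univ_two] at hv
      simp only [hM, Matrix.mulVec, dotProduct, Fin.sum_univ_two, Matrix.add_apply,
        Matrix.vecMulVec_apply, Matrix.one_apply]
      simp
      linear_combination (x 0 * v 0 + x 1 * v 1) ^ 2 * hv
    set S' := Function.update S p (M * S p) with hS'
    have hS'det : ∀ q, (S' q).det ≠ 0 := by
      intro q
      by_cases h : q = p
      · subst h; simp [hS', hMdet, hS q]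
      · simp [hS', h, hS q]
    have hN' : ∀ i, N S' i = N S i + 3 * (∑ α, (S p).mulVec (g i p) α * v α) ^ 2 := by
      intro i
      simp only [N]
      rw [← Finset.add_sum_erase _ _ (Finset.mem_univ p),
        ← Finset.add_sum_erase _ (fun q => ∑ α, (S q).mulVec (g i q) α ^ 2) (Finset.mem_univ p)]
      have h1 : ∑ q ∈ Finset.univ.erase p, ∑ α, (S' q).mulVec (g i q) α ^ 2 =
          ∑ q ∈ Finset.univ.erase p, ∑ α, (S q).mulVec (g i q) α ^ 2 :=
        Finset.sum_congr rfl fun q hq => by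
          simp only [hS', Function.update_of_ne (Finset.ne_of_mem_erase hq)]
      rw [h1]
      simp only [hS', Function.update_self, ← Matrix.mulVec_mulVec]
      rw [hMv]
      ring
    have h1 := hmin S' hS'det
    have h2 : f S' ≤ f S + 3 * ∑ i, (∑ α, (S p).mulVec (g i p) α * v α) ^ 2 / N S i -
        (s p).card / 6 * Real.log 4 := by
      have h3 : ∑ i, Real.log (N S' i) ≤ ∑ i, Real.log (N S i) +
          3 * ∑ i, (∑ α, (S p).mulVec (g i p) α * v α) ^ 2 / N S i := by
        rw [Finset.mul_sum, ← Finset.sum_add_distrib]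
        refine Finset.sum_le_sum fun i _ => ?_
        have h0 := hNpos S hS i
        have h0' := hNpos S' hS'det i
        have h5 := Real.log_le_sub_one_of_pos (div_pos h0' h0)
        rw [Real.log_div h0'.ne' h0.ne'] at h5
        have h6 : N S' i / N S i - 1 = 3 * ((∑ α, (S p).mulVec (g i p) α * v α) ^ 2 / N S i) := by
          rw [hN' i]; field_simp; ring
        linarith
      have h4 : ∑ q, (s q).card / 6 * Real.log ((S' q).det ^ 2) =
          ∑ q, (s q).card / 6 * Real.log ((S q).det ^ 2) + (s p).card / 6 * Real.log 4 := by
        rw [← Finset.add_sum_erase _ _ (Finset.mem_univ p), ← Finset.add_sum_erase _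
          (fun q => (s q).card / 6 * Real.log ((S q).det ^ 2)) (Finset.mem_univ p)]
        have h5 : ∑ q ∈ Finset.univ.erase p, ((s q).card / 6 * Real.log ((S' q).det ^ 2) : ℝ) =
            ∑ q ∈ Finset.univ.erase p, (s q).card / 6 * Real.log ((S q).det ^ 2) :=
          Finset.sum_congr rfl fun q hq => by
          simp only [hS', Function.update_of_ne (Finset.ne_of_mem_erase hq)]
        rw [h5]
        have hSp := hS p
        simp only [hS', Function.update_self, Matrix.det_mul, hMdet, mul_pow]
        rw [Real.log_mul (by norm_num) (by positivity)]
        norm_num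
        ring
      simp only [f]
      rw [h4]
      linarith
    have h3 : Real.log 4 = 2 * Real.log 2 := by
      rw [show (4 : ℝ) = 2 ^ 2 by norm_num, Real.log_pow]; norm_num
    have h4 := Real.log_two_gt_d9
    have h5 : (r : ℝ) ≤ (s p).card := by exact_mod_cast hdeg p
    have h6 : (2 : ℝ) ≤ r := by exact_mod_cast hr
    nlinarith
  refine ⟨S, fun i => (Real.sqrt (N S i))⁻¹, hS, fun i =>
    inv_ne_zero (Real.sqrt_ne_zero'.2 (hNpos S hS i)), fun i => ?_, fun p v => ?_⟩
  · have h0 := hNpos S hS i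
    simp only [mul_pow, inv_pow, Real.sq_sqrt h0.le, ← Finset.mul_sum]
    exact (inv_mul_cancel₀ h0.ne').le
  · have h1 : ∀ i, (∑ α, (Real.sqrt (N S i))⁻¹ * (S p).mulVec (g i p) α * v α) ^ 2 =
        (∑ α, (S p).mulVec (g i p) α * v α) ^ 2 / N S i := by
      intro i
      simp only [mul_assoc, ← Finset.mul_sum]
      rw [mul_pow, inv_pow, Real.sq_sqrt (hNpos S hS i).le]
      ring
    simp only [h1]
    set t := ∑ α, v α ^ 2 with ht
    have ht0 : 0 ≤ t := by positivity
    rcases ht0.eq_or_lt with h0 | h0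
    · rw [← h0, mul_zero]
      exact Finset.sum_nonneg fun i _ => div_nonneg (sq_nonneg _) (hNpos S hS i).le
    · have h2 := hunit p (fun α => v α / Real.sqrt t) (by
        simp only [div_pow, ← Finset.sum_div, Real.sq_sqrt ht0]
        exact div_self h0.ne')
      rw [← le_div_iff₀ h0]
      refine h2.trans (le_of_eq ?_)
      rw [Finset.sum_div]
      refine Finset.sum_congr rfl fun i _ => ?_
      simp only [mul_div_assoc', ← Finset.sum_div]
      rw [div_pow, Real.sq_sqrt ht0, div_right_comm]

theorem exists_affine_dependence {t : Finset (ℝ × ℝ)} (ht : t.card = 3)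
    (hinj : ∀ p ∈ t, ∀ q ∈ t, p ≠ q → p.1 ≠ q.1) :
    ∃ a : ℝ × ℝ → ℝ, (∀ q ∉ t, a q = 0) ∧ (∀ q ∈ t, a q ≠ 0) ∧ ∑ q ∈ t, a q = 0 ∧
      ∑ q ∈ t, a q * q.1 = 0 := by
  classical
  obtain ⟨x, y, z, hxy, hxz, hyz, rfl⟩ := Finset.card_eq_three.1 ht
  have h1 := hinj x (by simp) y (by simp) hxy
  have h2 := hinj x (by simp) z (by simp) hxz
  have h3 := hinj y (by simp) z (by simp) hyz
  refine ⟨fun q => if q = x then y.1 - z.1 else if q = y then z.1 - x.1 else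
    if q = z then x.1 - y.1 else 0, ?_, ?_, ?_, ?_⟩
  · intro q hq
    simp only [Finset.mem_insert, Finset.mem_singleton, not_or] at hq
    simp [hq]
  · intro q hq
    simp only [Finset.mem_insert, Finset.mem_singleton] at hq
    rcases hq with rfl | rfl | rfl
    · simpa [sub_eq_zero] using h3
    · simpa [hxy.symm, sub_eq_zero] using h2.symm
    · simpa [hxz.symm, hyz.symm, sub_eq_zero] using h1
  · rw [Finset.sum_insert (by simp [hxy, hxz]), Finset.sum_insert (by simp [hyz]),
      Finset.sum_singleton]
    simp [hxy.symm, hxz.symm, hyz.symm]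
  · rw [Finset.sum_insert (by simp [hxy, hxz]), Finset.sum_insert (by simp [hyz]),
      Finset.sum_singleton]
    simp only [if_true, hxy.symm, hxz.symm, hyz.symm, if_false]
    ring

theorem mulVec_dotProduct_transpose_inv {S : Matrix (Fin 2) (Fin 2) ℝ} (hS : S.det ≠ 0)
    (x y : Fin 2 → ℝ) : ∑ α, S.mulVec x α * (S⁻¹.transpose.mulVec y) α = ∑ α, x α * y α := by
  have h : S.mulVec x ⬝ᵥ S⁻¹.transpose.mulVec y = x ⬝ᵥ y := by
    rw [Matrix.dotProduct_mulVec, Matrix.vecMul_transpose, Matrix.mulVec_mulVec,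
      Matrix.nonsing_inv_mul _ (isUnit_iff_ne_zero.2 hS), Matrix.one_mulVec]
  exact h

theorem RigidLE.of_triples {A B : Finset (ℝ × ℝ)} (T : ℝ × ℝ → Finset (ℝ × ℝ))
    (hTA : ∀ l ∈ B, T l ⊆ A) (hT3 : ∀ l ∈ B, (T l).card = 3) (hTI : ∀ l ∈ B, ∀ p ∈ T l, Inc p l)
    (r : ℕ) (hr : 2 ≤ r) (hdeg : ∀ p ∈ A, r ≤ (B.filter fun l => p ∈ T l).card) (R : ℕ)
    (hR : (B.card : ℝ) < (R + 1) * (r / 20 : ℝ) ^ 2) : RigidLE A B R := by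
  classical
  intro u w hm
  have hα : ∀ l : B, ∃ a : ℝ × ℝ → ℝ, (∀ q ∉ T l, a q = 0) ∧ (∀ q ∈ T l, a q ≠ 0) ∧
      ∑ q ∈ T l, a q = 0 ∧ ∑ q ∈ T l, a q * q.1 = 0 := fun l =>
    exists_affine_dependence (hT3 l l.2) fun p hp q hq hpq =>
      (hTI l l.2 p hp).fst_ne (hTI l l.2 q hq) hpq
  choose a ha0 ha1 ha2 ha3 using hα
  let g : B → A → Fin 2 → ℝ := fun l q => ![-(l : ℝ × ℝ).1 * a l q, a l q]
  let T' : B → Finset A := fun l => Finset.univ.filter fun q => (q : ℝ × ℝ) ∈ T l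
  have hsum : ∀ (l : B) (f : ℝ × ℝ → ℝ), (∀ q ∉ T l, f q = 0) →
      ∑ q : A, f q = ∑ q ∈ T l, f q := by
    intro l f hf
    rw [Finset.sum_coe_sort A f]
    exact (Finset.sum_subset (hTA l l.2) fun q _ hq => hf q hq).symm
  obtain ⟨S, c, hS, hc, hnorm, hlow⟩ := exists_scaling g T' (by
      intro l
      rw [← hT3 l l.2, ← Finset.card_map (Function.Embedding.subtype _)]
      congr 1
      ext q
      simp only [Finset.mem_map, Finset.mem_filter, Finset.mem_univ, true_and, T',
        Function.Embedding.coe_subtype]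
      exact ⟨fun ⟨x, h1, h2⟩ => h2 ▸ h1, fun h => ⟨⟨q, hTA l l.2 h⟩, h, rfl⟩⟩) (by
      intro q l l' hne hq hq'
      simp only [T', Finset.mem_filter, Finset.mem_univ, true_and] at hq hq'
      have h1 := (hTI l l.2 q hq).symm.fst_ne (hTI l' l'.2 q hq').symm
        (fun h => hne (Subtype.ext h))
      have h2 : g l q 0 * g l' q 1 - g l q 1 * g l' q 0 =
          a l q * a l' q * ((l' : ℝ × ℝ).1 - (l : ℝ × ℝ).1) := by
        simp [g]; ring
      rw [h2]
      exact mul_ne_zero (mul_ne_zero (ha1 l q hq) (ha1 l' q hq')) (sub_ne_zero.2 h1.symm)) r hr (by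
      intro q
      refine (hdeg q q.2).trans (le_of_eq ?_)
      rw [← Finset.card_map (Function.Embedding.subtype _)]
      congr 1
      ext l
      simp only [Finset.mem_map, Finset.mem_filter, Finset.mem_univ, true_and, T',
        Function.Embedding.coe_subtype]
      exact ⟨fun ⟨h1, h2⟩ => ⟨⟨l, h1⟩, h2, rfl⟩, fun ⟨x, h1, h2⟩ => h2 ▸ ⟨x.2, h1⟩⟩)
  let b : B → A → Fin 2 → ℝ := fun l q α => c l * (S q).mulVec (g l q) α
  have hbT : ∀ l q, b l q ≠ 0 → (q : ℝ × ℝ) ∈ T l := by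
    intro l q h
    by_contra hq
    refine h ?_
    have h0 : g l q = 0 := by
      ext i; fin_cases i <;> simp [g, ha0 l q hq]
    ext i; simp only [b, h0, Matrix.mulVec_zero, Pi.zero_apply, mul_zero]
  let W : Submodule ℝ (EuclideanSpace ℝ (A × Fin 2)) :=
    { carrier := {v | ∀ l, ∑ q, ∑ α, b l q α * v (q, α) = 0}
      add_mem' := fun {x y} hx hy l => by
        simp only [Set.mem_ofPred_eq] at hx hy
        simp only [PiLp.add_apply, mul_add, Finset.sum_add_distrib, hx l, hy l, add_zero]
      zero_mem' := fun l => by simp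
      smul_mem' := fun t x hx l => by
        simp only [Set.mem_ofPred_eq] at hx
        simp only [PiLp.smul_apply, smul_eq_mul, mul_left_comm _ t, ← Finset.mul_sum, hx l,
          mul_zero] }
  have hrank := finrank_mul_sq_le_of_rows b (r / 20) (by positivity) hnorm hlow (by
      intro p q hpq l l' hll
      by_contra! h
      exact hll (Subtype.ext ((hTI l l.2 p (hbT l p h.1)).eq_of_ne (hTI l l.2 q (hbT l q h.2.1))
        (hTI l' l'.2 p (hbT l' p h.2.2.1)) (hTI l' l'.2 q (hbT l' q h.2.2.2))
        fun h => hpq (Subtype.ext h)))) W fun v hv => hv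
  have hrank' : Module.finrank ℝ W < R + 1 := by
    have h0 : (0 : ℝ) < r := by exact_mod_cast (by omega : 0 < r)
    rw [Fintype.card_coe] at hrank
    have h1 := lt_of_mul_lt_mul_right (hrank.trans_lt hR) (by positivity)
    exact_mod_cast h1
  let U : Fin (R + 1) → A → Fin 2 → ℝ := fun j q => ![(u j q).1, (u j q).2]
  let v : Fin (R + 1) → W := fun j => ⟨WithLp.toLp 2 fun s => (S s.1)⁻¹.transpose.mulVec (U j s.1) s.2, by
    intro l
    have h1 : ∀ q : A, ∑ α, b l q α * ((S q)⁻¹.transpose.mulVec (U j q)) α =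
        c l * (a l q * ((u j q).2 - (u j q).1 * (l : ℝ × ℝ).1)) := by
      intro q
      simp only [b, mul_assoc, ← Finset.mul_sum]
      rw [mulVec_dotProduct_transpose_inv (hS q)]
      simp [g, U]
      left; ring
    simp only [h1, ← Finset.mul_sum]
    rw [hsum l (fun q => a l q * ((u j q).2 - (u j q).1 * (l : ℝ × ℝ).1)) fun q hq => by
      rw [ha0 l q hq, zero_mul]]
    have h2 : ∀ q ∈ T l, a l q * ((u j q).2 - (u j q).1 * (l : ℝ × ℝ).1) =
        (a l q * q.1) * (w j l).1 - a l q * (w j l).2 := by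
      intro q hq
      have := hm j q (hTA l l.2 hq) l l.2 (hTI l l.2 q hq)
      linear_combination a l q * this
    rw [Finset.sum_congr rfl h2, Finset.sum_sub_distrib, ← Finset.sum_mul, ← Finset.sum_mul,
      ha2, ha3]
    simp⟩
  have hdep : ¬ LinearIndependent ℝ v := fun h => by
    have := h.fintype_card_le_finrank
    rw [Fintype.card_fin] at this
    omega
  obtain ⟨d, hd, j, hj⟩ := Fintype.not_linearIndependent_iff.1 hdep
  have hu : ∀ p ∈ A, ∑ j, d j • u j p = 0 := by
    intro p hp
    have h1 : ∀ α, ∑ j, d j * ((S ⟨p, hp⟩)⁻¹.transpose.mulVec (U j ⟨p, hp⟩)) α = 0 := by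
      intro α
      have h2 := congrArg (fun x : W => (x : EuclideanSpace ℝ (A × Fin 2)) (⟨p, hp⟩, α)) hd
      simpa [v, Submodule.coe_sum] using h2
    have h2 : (S ⟨p, hp⟩)⁻¹.transpose.mulVec (∑ j, d j • U j ⟨p, hp⟩) = 0 := by
      ext α
      rw [Matrix.mulVec_sum, Finset.sum_apply]
      simpa [Matrix.mulVec_smul] using h1 α
    have h3 : ∑ j, d j • U j ⟨p, hp⟩ = 0 := by
      have h4 := congrArg ((S ⟨p, hp⟩).transpose.mulVec) h2
      rw [Matrix.mulVec_mulVec, ← Matrix.transpose_mul,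
        Matrix.nonsing_inv_mul _ (isUnit_iff_ne_zero.2 (hS _)), Matrix.transpose_one,
        Matrix.one_mulVec, Matrix.mulVec_zero] at h4
      exact h4
    have h4 := congrFun h3 0
    have h5 := congrFun h3 1
    refine Prod.ext ?_ ?_
    · simpa [U, Prod.fst_sum] using h4
    · simpa [U, Prod.snd_sum] using h5
  refine ⟨d, fun h => hj (by rw [h]; rfl), hu, fun l hl => ?_⟩
  obtain ⟨x, hx, y, hy, hxy⟩ := Finset.one_lt_card.1 (by rw [hT3 l hl]; norm_num : 1 < (T l).card)
  have hw : ∀ q ∈ T l, (∑ j, d j • w j l).2 = q.1 * (∑ j, d j • w j l).1 := by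
    intro q hq
    have h1 := hu q (hTA l hl hq)
    have h2 : (∑ j, d j • u j q).2 + (∑ j, d j • w j l).2 =
        (∑ j, d j • u j q).1 * l.1 + q.1 * (∑ j, d j • w j l).1 := by
      simp only [Prod.fst_sum, Prod.snd_sum, Prod.smul_fst, Prod.smul_snd, smul_eq_mul,
        Finset.sum_mul, Finset.mul_sum, ← Finset.sum_add_distrib]
      refine Finset.sum_congr rfl fun j _ => ?_
      linear_combination d j * hm j q (hTA l hl hq) l hl (hTI l hl q hq)
    rw [h1] at h2
    simpa using h2
  have h1 := (hTI l hl x hx).fst_ne (hTI l hl y hy) hxy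
  have h2 := hw x hx
  have h3 := hw y hy
  have h4 : (∑ j, d j • w j l).1 = 0 := by
    have : (x.1 - y.1) * (∑ j, d j • w j l).1 = 0 := by linarith
    exact (mul_eq_zero.1 this).resolve_left (sub_ne_zero.2 h1)
  exact Prod.ext h4 (by rw [h2, h4, mul_zero]; rfl)

/-- The height at abscissa `x` of the line `l`. -/
def height (l : ℝ × ℝ) (x : ℝ) : ℝ := x * l.1 - l.2

theorem inc_iff_height {p l : ℝ × ℝ} : Inc p l ↔ p.2 = height l p.1 := by
  unfold Inc height
  constructor <;> intro h <;> linarith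

/-- Lines ordered by height just to the right of `x`. -/
def heightKey (x : ℝ) (l : ℝ × ℝ) : ℝ ×ₗ ℝ := toLex (height l x, l.1)

theorem heightKey_injective (x : ℝ) : Function.Injective (heightKey x) := by
  intro l k h
  have h1 := congrArg ofLex h
  simp only [heightKey, ofLex_toLex, Prod.mk.injEq, height] at h1
  refine Prod.ext h1.2 ?_
  have := h1.1
  rw [h1.2] at this
  linarith

theorem heightKey_lt_iff {x : ℝ} {l k : ℝ × ℝ} : heightKey x l < heightKey x k ↔
    height l x < height k x ∨ height l x = height k x ∧ l.1 < k.1 := by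
  simp [heightKey, Prod.Lex.toLex_lt_toLex]

theorem heightKey_lt_of_height_lt {x : ℝ} {l k : ℝ × ℝ} (h : height l x < height k x) :
    heightKey x l < heightKey x k := heightKey_lt_iff.2 (Or.inl h)

/-- The abscissa at which the lines `c` and `a` cross, or `M` if they are parallel. -/
def wall (M : ℝ) (c a : ℝ × ℝ) : ℝ := if c.1 = a.1 then M else (c.2 - a.2) / (c.1 - a.1)

theorem wall_comm (M : ℝ) (c a : ℝ × ℝ) : wall M c a = wall M a c := by
  unfold wall
  by_cases h : c.1 = a.1
  · rw [if_pos h, if_pos h.symm]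
  · rw [if_neg h, if_neg (Ne.symm h), ← neg_sub a.2, ← neg_sub a.1, neg_div_neg_eq]

theorem heightKey_lt_iff_wall_le {M x : ℝ} {c a : ℝ × ℝ} (h : c.1 < a.1) :
    heightKey x c < heightKey x a ↔ wall M c a ≤ x := by
  rw [heightKey_lt_iff, wall, if_neg h.ne, div_le_iff_of_neg (sub_neg.2 h)]
  unfold height
  constructor
  · rintro (h1 | h1) <;> linarith
  · intro h1
    rcases h1.lt_or_eq with h2 | h2
    · left; linarith
    · exact Or.inr ⟨by linarith, h⟩

theorem wall_separates {M x y : ℝ} {c a : ℝ × ℝ} (hx : heightKey x c < heightKey x a)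
    (hy : heightKey y a < heightKey y c) : ¬ (wall M c a ≤ x ↔ wall M c a ≤ y) := by
  rcases lt_trichotomy c.1 a.1 with h | h | h
  · rw [← heightKey_lt_iff_wall_le h, ← heightKey_lt_iff_wall_le h]
    exact fun h' => hy.not_gt (h'.1 hx)
  · exfalso
    rw [heightKey_lt_iff] at hx hy
    unfold height at hx hy
    rw [h] at hx hy
    rcases hx with hx | hx <;> rcases hy with hy | hy <;> linarith
  · rw [wall_comm, ← heightKey_lt_iff_wall_le h, ← heightKey_lt_iff_wall_le h]
    exact fun h' => hx.not_gt (h'.2 hy)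

/-- `a` is the first line of `R` above `p`. -/
def LineAbove (R : Finset (ℝ × ℝ)) (p a : ℝ × ℝ) : Prop :=
  a ∈ R ∧ p.2 < height a p.1 ∧ ∀ c ∈ R, p.2 < height c p.1 → heightKey p.1 a ≤ heightKey p.1 c

/-- `b` is the first line of `R` below `p`. -/
def LineBelow (R : Finset (ℝ × ℝ)) (p b : ℝ × ℝ) : Prop :=
  b ∈ R ∧ height b p.1 < p.2 ∧ ∀ c ∈ R, height c p.1 < p.2 → heightKey p.1 c ≤ heightKey p.1 b

theorem LineAbove.unique {R : Finset (ℝ × ℝ)} {p a a' : ℝ × ℝ} (h : LineAbove R p a)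
    (h' : LineAbove R p a') :
    a = a' :=
  heightKey_injective p.1 ((h.2.2 a' h'.1 h'.2.1).antisymm (h'.2.2 a h.1 h.2.1))

theorem LineBelow.unique {R : Finset (ℝ × ℝ)} {p b b' : ℝ × ℝ} (h : LineBelow R p b)
    (h' : LineBelow R p b') :
    b = b' :=
  heightKey_injective p.1 ((h'.2.2 b h.1 h.2.1).antisymm (h.2.2 b' h'.1 h'.2.1))

/-- No crossing of `a` with a line of `R` lies between `x` and `y`. -/
def SameSide (M : ℝ) (R : Finset (ℝ × ℝ)) (a : ℝ × ℝ) (x y : ℝ) : Prop :=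
  ∀ c ∈ R, (wall M c a ≤ x ↔ wall M c a ≤ y)

/-- The cell of `p` in the vertical decomposition of the arrangement `R`. -/
def cell (M : ℝ) (R : Finset (ℝ × ℝ)) (p : ℝ × ℝ) : Set (ℝ × ℝ) :=
  {q | ∃ a b, LineAbove R p a ∧ LineBelow R p b ∧ height b q.1 < q.2 ∧ q.2 < height a q.1 ∧
    SameSide M R a p.1 q.1 ∧ SameSide M R b p.1 q.1}

theorem not_inc_of_mem_cell {M : ℝ} {R : Finset (ℝ × ℝ)} {p q l : ℝ × ℝ} (hq : q ∈ cell M R p)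
    (hl : l ∈ R) (hp : ¬ Inc p l) : ¬ Inc q l := by
  intro hql
  obtain ⟨a, b, ha, hb, hqb, hqa, hsa, hsb⟩ := hq
  rw [inc_iff_height] at hp hql
  rcases lt_or_gt_of_ne hp with h | h
  · have h1 : heightKey q.1 l < heightKey q.1 a := heightKey_lt_of_height_lt (hql ▸ hqa)
    have h2 := ha.2.2 l hl h
    rcases h2.lt_or_eq with h2 | h2
    · exact wall_separates h1 h2 (hsa l hl).symm
    · rw [heightKey_injective _ h2] at h1
      exact lt_irrefl _ h1
  · have h1 : heightKey q.1 b < heightKey q.1 l := heightKey_lt_of_height_lt (hql ▸ hqb)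
    have h2 := hb.2.2 l hl h
    rcases h2.lt_or_eq with h2 | h2
    · exact wall_separates h2 h1 (hsb l hl)
    · rw [heightKey_injective _ h2] at h1
      exact lt_irrefl _ h1

theorem exists_sameSide_witnesses (M : ℝ) {R : Finset (ℝ × ℝ)} {a : ℝ × ℝ} (ha : a ∈ R) (x : ℝ) :
    ∃ c ∈ R, ∃ d ∈ R, ∀ y, (wall M c a ≤ x ↔ wall M c a ≤ y) → (wall M d a ≤ x ↔ wall M d a ≤ y) →
      SameSide M R a x y := by
  classical
  have h1 : ∃ c ∈ R, ∀ e ∈ R, wall M e a ≤ x → wall M c a ≤ x ∧ wall M e a ≤ wall M c a := by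
    rcases (R.filter fun e => wall M e a ≤ x).eq_empty_or_nonempty with h | h
    · exact ⟨a, ha, fun e he hx => absurd hx (Finset.filter_eq_empty_iff.1 h he)⟩
    · obtain ⟨c, hc, hmax⟩ := Finset.exists_max_image _ (fun e => wall M e a) h
      rw [Finset.mem_filter] at hc
      exact ⟨c, hc.1, fun e he hx => ⟨hc.2, hmax e (Finset.mem_filter.2 ⟨he, hx⟩)⟩⟩
  have h2 : ∃ c ∈ R, ∀ e ∈ R, x < wall M e a → x < wall M c a ∧ wall M c a ≤ wall M e a := by
    rcases (R.filter fun e => x < wall M e a).eq_empty_or_nonempty with h | h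
    · exact ⟨a, ha, fun e he hx => absurd hx (Finset.filter_eq_empty_iff.1 h he)⟩
    · obtain ⟨c, hc, hmin⟩ := Finset.exists_min_image _ (fun e => wall M e a) h
      rw [Finset.mem_filter] at hc
      exact ⟨c, hc.1, fun e he hx => ⟨hc.2, hmin e (Finset.mem_filter.2 ⟨he, hx⟩)⟩⟩
  obtain ⟨c, hc, hc'⟩ := h1
  obtain ⟨d, hd, hd'⟩ := h2
  refine ⟨c, hc, d, hd, fun y hcy hdy e he => ⟨fun h => ?_, fun h => ?_⟩⟩
  · obtain ⟨h3, h4⟩ := hc' e he h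
    exact h4.trans (hcy.1 h3)
  · by_contra h5
    obtain ⟨h3, h4⟩ := hd' e he (not_le.1 h5)
    exact h3.not_ge (hdy.2 (h4.trans h))

theorem exists_cell_witnesses (M : ℝ) {R : Finset (ℝ × ℝ)} {p a b : ℝ × ℝ} (ha : LineAbove R p a)
    (hb : LineBelow R p b) : ∃ W ⊆ R, W.card ≤ 6 ∧
      ∀ R' ⊆ R, W ⊆ R' → cell M R' p = cell M R p := by
  classical
  obtain ⟨c, hc, d, hd, hcd⟩ := exists_sameSide_witnesses M ha.1 p.1
  obtain ⟨e, he, f, hf, hef⟩ := exists_sameSide_witnesses M hb.1 p.1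
  refine ⟨{a, b, c, d, e, f}, ?_, Finset.card_le_six, fun R' hR' hW => ?_⟩
  · simp only [Finset.insert_subset_iff, Finset.singleton_subset_iff]
    exact ⟨ha.1, hb.1, hc, hd, he, hf⟩
  simp only [Finset.insert_subset_iff, Finset.singleton_subset_iff] at hW
  have ha' : LineAbove R' p a := ⟨hW.1, ha.2.1, fun c hc h => ha.2.2 c (hR' hc) h⟩
  have hb' : LineBelow R' p b := ⟨hW.2.1, hb.2.1, fun c hc h => hb.2.2 c (hR' hc) h⟩
  ext q
  constructor
  · rintro ⟨a₁, b₁, ha₁, hb₁, h1, h2, h3, h4⟩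
    obtain rfl := ha₁.unique ha'
    obtain rfl := hb₁.unique hb'
    exact ⟨_, _, ha, hb, h1, h2, hcd _ (h3 c hW.2.2.1) (h3 d hW.2.2.2.1),
      hef _ (h4 e hW.2.2.2.2.1) (h4 f hW.2.2.2.2.2)⟩
  · rintro ⟨a₁, b₁, ha₁, hb₁, h1, h2, h3, h4⟩
    obtain rfl := ha₁.unique ha
    obtain rfl := hb₁.unique hb
    exact ⟨_, _, ha', hb', h1, h2, fun c hc => h3 c (hR' hc), fun c hc => h4 c (hR' hc)⟩

theorem exists_lineAbove {R : Finset (ℝ × ℝ)} {p z : ℝ × ℝ} (hz : z ∈ R) (hp : p.2 < height z p.1) :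
    ∃ a, LineAbove R p a := by
  classical
  obtain ⟨a, ha, hmin⟩ := Finset.exists_min_image (R.filter fun c => p.2 < height c p.1)
    (heightKey p.1) ⟨z, Finset.mem_filter.2 ⟨hz, hp⟩⟩
  rw [Finset.mem_filter] at ha
  exact ⟨a, ha.1, ha.2, fun c hc h => hmin c (Finset.mem_filter.2 ⟨hc, h⟩)⟩

theorem exists_lineBelow {R : Finset (ℝ × ℝ)} {p z : ℝ × ℝ} (hz : z ∈ R) (hp : height z p.1 < p.2) :
    ∃ b, LineBelow R p b := by
  classical
  obtain ⟨a, ha, hmax⟩ := Finset.exists_max_image (R.filter fun c => height c p.1 < p.2)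
    (heightKey p.1) ⟨z, Finset.mem_filter.2 ⟨hz, hp⟩⟩
  rw [Finset.mem_filter] at ha
  exact ⟨a, ha.1, ha.2, fun c hc h => hmax c (Finset.mem_filter.2 ⟨hc, h⟩)⟩

/-- `c` gives the last crossing of `a` with a line of `R` to the left of `x`. -/
def IsLeftWall (M : ℝ) (R : Finset (ℝ × ℝ)) (a : ℝ × ℝ) (x : ℝ) (c : ℝ × ℝ) : Prop :=
  c ∈ R ∧ wall M c a ≤ x ∧ ∀ d ∈ R, wall M d a ≤ x → wall M d a ≤ wall M c a

theorem exists_isLeftWall {M : ℝ} {R : Finset (ℝ × ℝ)} {a : ℝ × ℝ} {x : ℝ} (ha : a ∈ R)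
    (hM : M ≤ x) : ∃ c, IsLeftWall M R a x c := by
  classical
  obtain ⟨c, hc, hmax⟩ := Finset.exists_max_image (R.filter fun c => wall M c a ≤ x)
    (fun c => wall M c a) ⟨a, Finset.mem_filter.2 ⟨ha, by simpa [wall] using hM⟩⟩
  rw [Finset.mem_filter] at hc
  exact ⟨c, hc.1, hc.2, fun d hd h => hmax d (Finset.mem_filter.2 ⟨hd, h⟩)⟩

theorem mem_cell_of_top {M : ℝ} {R : Finset (ℝ × ℝ)} {p q a b b' c d d' : ℝ × ℝ}
    (hp : ∀ l ∈ R, ¬ Inc p l) (hq : ∀ l ∈ R, ¬ Inc q l)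
    (hpa : LineAbove R p a) (hqa : LineAbove R q a) (hpb : LineBelow R p b) (hqb : LineBelow R q b')
    (hpc : IsLeftWall M R a p.1 c) (hqc : IsLeftWall M R a q.1 c)
    (hpd : IsLeftWall M R b p.1 d) (hqd : IsLeftWall M R b' q.1 d')
    (hp' : wall M d b ≤ wall M c a) (hq' : wall M d' b' ≤ wall M c a) : q ∈ cell M R p := by
  have hsa : SameSide M R a p.1 q.1 := fun e he =>
    ⟨fun h => (hpc.2.2 e he h).trans hqc.2.1, fun h => (hqc.2.2 e he h).trans hpc.2.1⟩
  have hbb : b = b' := by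
    by_contra hne
    have h1 : ∀ {p q a b b' : ℝ × ℝ}, (∀ l ∈ R, ¬ Inc p l) → LineAbove R p a → LineAbove R q a →
        LineBelow R p b → LineBelow R q b' → b ≠ b' → SameSide M R a p.1 q.1 →
        heightKey p.1 b' < heightKey p.1 b := by
      intro p q a b b' hp hpa hqa hpb hqb hne hsa
      rcases lt_or_gt_of_ne (inc_iff_height.not.1 (hp b' hqb.1)) with h | h
      · exfalso
        have h2 := heightKey_lt_of_height_lt (hqb.2.1.trans hqa.2.1)
        rcases (hpa.2.2 b' hqb.1 h).lt_or_eq with h3 | h3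
        · exact wall_separates h2 h3 (hsa b' hqb.1).symm
        · rw [heightKey_injective _ h3] at h2
          exact lt_irrefl _ h2
      · exact (hpb.2.2 b' hqb.1 h).lt_of_ne fun h => hne (heightKey_injective _ h).symm
    have h2 := h1 hp hpa hqa hpb hqb hne hsa
    have h3 := h1 hq hqa hpa hqb hpb (Ne.symm hne) fun e he => (hsa e he).symm
    refine wall_separates (M := M) h2 h3 ⟨fun h => ?_, fun h => ?_⟩
    · exact ((hpd.2.2 b' hqb.1 h).trans hp').trans hqc.2.1
    · rw [wall_comm] at h ⊢
      exact ((hqd.2.2 b hpb.1 h).trans hq').trans hpc.2.1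
  subst hbb
  exact ⟨a, b, hpa, hpb, hqb.2.1, hqa.2.1, hsa, fun e he =>
    ⟨fun h => ((hpd.2.2 e he h).trans hp').trans hqc.2.1,
     fun h => ((hqd.2.2 e he h).trans hq').trans hpc.2.1⟩⟩

theorem mem_cell_of_bot {M : ℝ} {R : Finset (ℝ × ℝ)} {p q a a' b c d d' : ℝ × ℝ}
    (hp : ∀ l ∈ R, ¬ Inc p l) (hq : ∀ l ∈ R, ¬ Inc q l)
    (hpb : LineBelow R p b) (hqb : LineBelow R q b) (hpa : LineAbove R p a) (hqa : LineAbove R q a')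
    (hpc : IsLeftWall M R b p.1 c) (hqc : IsLeftWall M R b q.1 c)
    (hpd : IsLeftWall M R a p.1 d) (hqd : IsLeftWall M R a' q.1 d')
    (hp' : wall M d a ≤ wall M c b) (hq' : wall M d' a' ≤ wall M c b) : q ∈ cell M R p := by
  have hsb : SameSide M R b p.1 q.1 := fun e he =>
    ⟨fun h => (hpc.2.2 e he h).trans hqc.2.1, fun h => (hqc.2.2 e he h).trans hpc.2.1⟩
  have haa : a = a' := by
    by_contra hne
    have h1 : ∀ {p q a a' b : ℝ × ℝ}, (∀ l ∈ R, ¬ Inc p l) → LineBelow R p b → LineBelow R q b →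
        LineAbove R p a → LineAbove R q a' → a ≠ a' → SameSide M R b p.1 q.1 →
        heightKey p.1 a < heightKey p.1 a' := by
      intro p q a a' b hp hpb hqb hpa hqa hne hsb
      rcases lt_or_gt_of_ne (inc_iff_height.not.1 (hp a' hqa.1)) with h | h
      · exact (hpa.2.2 a' hqa.1 h).lt_of_ne fun h => hne (heightKey_injective _ h)
      · exfalso
        have h2 := heightKey_lt_of_height_lt (hqb.2.1.trans hqa.2.1)
        rcases (hpb.2.2 a' hqa.1 h).lt_or_eq with h3 | h3
        · exact wall_separates h3 h2 (hsb a' hqa.1)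
        · rw [heightKey_injective _ h3] at h2
          exact lt_irrefl _ h2
    have h2 := h1 hp hpb hqb hpa hqa hne hsb
    have h3 := h1 hq hqb hpb hqa hpa (Ne.symm hne) fun e he => (hsb e he).symm
    refine wall_separates (M := M) h2 h3 ⟨fun h => ?_, fun h => ?_⟩
    · rw [wall_comm] at h ⊢
      exact ((hpd.2.2 a' hqa.1 h).trans hp').trans hqc.2.1
    · exact ((hqd.2.2 a hpa.1 h).trans hq').trans hpc.2.1
  subst haa
  exact ⟨a, b, hpa, hpb, hqb.2.1, hqa.2.1, fun e he =>
    ⟨fun h => ((hpd.2.2 e he h).trans hp').trans hqc.2.1,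
     fun h => ((hqd.2.2 e he h).trans hq').trans hpc.2.1⟩, hsb⟩

open Classical in
theorem card_filter_mem_powersetCard_le {α : Type*} (L : Finset α) (l : α) (hl : l ∈ L) (r : ℕ) :
    ((L.powersetCard (r + 1)).filter fun R => l ∈ R).card ≤ (L.card - 1).choose r := by
  rw [← Finset.card_erase_of_mem hl, ← Finset.card_powersetCard]
  refine Finset.card_le_card_of_injOn (fun R => R.erase l) ?_ ?_
  · intro R hR
    simp only [Finset.coe_filter, Finset.mem_powersetCard, Set.mem_ofPred_eq] at hR
    simp only [Finset.mem_coe, Finset.mem_powersetCard]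
    exact ⟨Finset.erase_subset_erase _ hR.1.1, by rw [Finset.card_erase_of_mem hR.2, hR.1.2]; simp⟩
  · intro R hR R' hR' h
    simp only [Finset.coe_filter, Set.mem_ofPred_eq] at hR hR'
    have h' : R.erase l = R'.erase l := h
    rw [← Finset.insert_erase hR.2, h', Finset.insert_erase hR'.2]

open Classical in
theorem card_filter_exists_mem_powersetCard_le {α : Type*} (L : Finset α) (Q : α → Prop) (r : ℕ)
    (hr : 1 ≤ r) (hQ : 8 * r * (L.filter Q).card ≤ L.card) :
    8 * ((L.powersetCard r).filter fun R => ∃ l ∈ R, Q l).card ≤ L.card.choose r := by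
  obtain ⟨r, rfl⟩ : ∃ s, r = s + 1 := ⟨r - 1, by omega⟩
  rcases L.eq_empty_or_nonempty with rfl | hL
  · rw [Finset.filter_eq_empty_iff.2]
    · simp
    · rintro R hR ⟨l, hl, -⟩
      exact absurd ((Finset.mem_powersetCard.1 hR).1 hl) (Finset.notMem_empty l)
  have h1 : ((L.powersetCard (r + 1)).filter fun R => ∃ l ∈ R, Q l).card ≤
      (L.filter Q).card * (L.card - 1).choose r := by
    rw [← smul_eq_mul, ← Finset.sum_const]
    refine le_trans (Finset.card_le_card (t := (L.filter Q).biUnion fun l =>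
      (L.powersetCard (r + 1)).filter fun R => l ∈ R) ?_) (Finset.card_biUnion_le.trans
      (Finset.sum_le_sum fun l hl => card_filter_mem_powersetCard_le L l (Finset.mem_filter.1 hl).1 r))
    intro R hR
    obtain ⟨hR, l, hl, hQ⟩ := Finset.mem_filter.1 hR
    simp only [Finset.mem_biUnion, Finset.mem_filter]
    exact ⟨l, ⟨(Finset.mem_powersetCard.1 hR).1 hl, hQ⟩, hR, hl⟩
  have h2 : L.card * (L.card - 1).choose r = L.card.choose (r + 1) * (r + 1) := by
    have := Nat.add_one_mul_choose_eq (L.card - 1) r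
    rwa [Nat.sub_add_cancel hL.card_pos] at this
  refine Nat.le_of_mul_le_mul_left ?_ hL.card_pos
  calc L.card * (8 * _) ≤ L.card * (8 * ((L.filter Q).card * (L.card - 1).choose r)) := by gcongr
    _ = 8 * (L.filter Q).card * (L.card * (L.card - 1).choose r) := by ring
    _ = (8 * (r + 1) * (L.filter Q).card) * L.card.choose (r + 1) := by rw [h2]; ring
    _ ≤ L.card * L.card.choose (r + 1) := by gcongr

open Classical in
theorem sum_card_conflict_le (M H : ℝ) (L : Finset (ℝ × ℝ)) (r : ℕ) (p : ℝ × ℝ) (hp : |p.2| < H) :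
    ∑ R ∈ L.powersetCard r, (L.filter fun l => ¬ Inc p l ∧
      ∃ q ∈ cell M (R ∪ {(0, H), (0, -H)}) p, Inc q l).card ≤ 6 * L.card.choose (r + 1) := by
  set Z : Finset (ℝ × ℝ) := {(0, H), (0, -H)} with hZ
  have hp' := abs_lt.1 hp
  have hex : ∀ R' : Finset (ℝ × ℝ), ∃ W ⊆ R' ∪ Z, W.card ≤ 6 ∧
      ∀ R ⊆ R' ∪ Z, W ⊆ R → cell M R p = cell M (R' ∪ Z) p := by
    intro R'
    obtain ⟨a, ha⟩ := exists_lineAbove (R := R' ∪ Z) (p := p) (z := (0, -H)) (by simp [hZ])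
      (by simpa [height] using hp'.2)
    obtain ⟨b, hb⟩ := exists_lineBelow (R := R' ∪ Z) (p := p) (z := (0, H)) (by simp [hZ])
      (by simpa [height] using hp'.1)
    exact exists_cell_witnesses M ha hb
  choose W hWs hW6 hW using hex
  rw [← Finset.card_powersetCard, mul_comm, ← smul_eq_mul, ← Finset.sum_const,
    ← Finset.card_sigma]
  refine le_trans ?_ (Finset.sum_le_sum (f := fun R' => (W R').card) fun R' _ => hW6 R')
  rw [← Finset.card_sigma]
  refine Finset.card_le_card_of_injOn (fun x => ⟨insert x.2 x.1, x.2⟩) ?_ ?_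
  · rintro ⟨R, l⟩ hx
    simp only [Finset.coe_sigma, Set.mem_sigma_iff, Finset.mem_coe, Finset.mem_powersetCard,
      Finset.mem_filter] at hx ⊢
    obtain ⟨⟨hRL, hR⟩, hlL, hpl, q, hq, hql⟩ := hx
    have hlR : l ∉ R := fun h => not_inc_of_mem_cell hq (Finset.mem_union_left _ h) hpl hql
    refine ⟨⟨Finset.insert_subset hlL hRL, by rw [Finset.card_insert_of_notMem hlR, hR]⟩, ?_⟩
    by_contra hlW
    have hsub : R ∪ Z ⊆ insert l R ∪ Z :=
      Finset.union_subset_union_left (Finset.subset_insert _ _)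
    have h1 := hW (insert l R) (R ∪ Z) hsub (fun c hc => by
      have hcl : c ≠ l := fun h => hlW (h ▸ hc)
      have := hWs _ hc
      simp only [Finset.mem_union, Finset.mem_insert] at this ⊢
      tauto)
    rw [h1] at hq
    exact not_inc_of_mem_cell hq (Finset.mem_union_left _ (Finset.mem_insert_self _ _)) hpl hql
  · rintro ⟨R, l⟩ hx ⟨R', l'⟩ hx' h
    simp only [Finset.coe_sigma, Set.mem_sigma_iff, Finset.mem_coe, Finset.mem_filter] at hx hx'
    have hlR : l ∉ R := fun h => by
      obtain ⟨-, -, hpl, q, hq, hql⟩ := hx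
      exact not_inc_of_mem_cell hq (Finset.mem_union_left _ h) hpl hql
    have hlR' : l' ∉ R' := fun h => by
      obtain ⟨-, -, hpl, q, hq, hql⟩ := hx'
      exact not_inc_of_mem_cell hq (Finset.mem_union_left _ h) hpl hql
    simp only [Sigma.mk.injEq, heq_eq_eq] at h
    obtain ⟨h1, rfl⟩ := h
    have : R = R' := by
      rw [← Finset.erase_insert hlR, h1, Finset.erase_insert hlR']
    rw [this]

open Classical in
theorem exists_partition (P L : Finset (ℝ × ℝ)) (w : ℝ × ℝ → ℝ) (hw : ∀ p ∈ P, 0 ≤ w p) (r : ℕ)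
    (hr : 1 ≤ r) (hrL : r ≤ L.card)
    (hdeg : ∀ p ∈ P, 8 * r * (L.filter fun l => Inc p l).card ≤ L.card) :
    ∃ G ⊆ P, ∑ p ∈ P, w p ≤ 2 * ∑ p ∈ G, w p ∧
      ∃ (κ : ℝ × ℝ → Bool × (ℝ × ℝ) × (ℝ × ℝ)) (K : Finset (Bool × (ℝ × ℝ) × (ℝ × ℝ))),
        (∀ p ∈ G, κ p ∈ K) ∧ K.card ≤ 18 * r ^ 2 ∧
        ∀ k, r * (L.filter fun l => ∃ p ∈ G, κ p = k ∧ Inc p l).card ≤ 25 * L.card := by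
  have hm0 : 0 < L.card := by omega
  obtain ⟨H, hH⟩ : ∃ H, ∀ p ∈ P, |p.2| < H := by
    obtain ⟨H, hH⟩ := (P.image fun p => |p.2|).exists_le
    exact ⟨H + 1, fun p hp => (hH _ (Finset.mem_image_of_mem _ hp)).trans_lt (by linarith)⟩
  obtain ⟨M, hM⟩ : ∃ M, ∀ p ∈ P, M ≤ p.1 := by
    obtain ⟨M, hM⟩ := (P.image fun p => -p.1).exists_le
    exact ⟨-M, fun p hp => by have := hM _ (Finset.mem_image_of_mem _ hp); linarith⟩
  set Z : Finset (ℝ × ℝ) := {(0, H), (0, -H)} with hZ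
  let conf : Finset (ℝ × ℝ) → ℝ × ℝ → ℕ := fun R p => (L.filter fun l => ¬ Inc p l ∧
      ∃ q ∈ cell M (R ∪ Z) p, Inc q l).card
  let B : Finset (ℝ × ℝ) → ℝ × ℝ → ℝ := fun R p =>
    r * conf R p / (24 * L.card) + 2 * if ∃ l ∈ R, Inc p l then 1 else 0
  have hB : ∀ p ∈ P, ∑ R ∈ L.powersetCard r, B R p ≤ L.card.choose r / 2 := by
    intro p hp
    have h1 : (∑ R ∈ L.powersetCard r, (conf R p : ℝ)) ≤ 6 * L.card.choose (r + 1) := by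
      exact_mod_cast sum_card_conflict_le M H L r p (hH p hp)
    have h2 : (8 : ℝ) * ((L.powersetCard r).filter fun R => ∃ l ∈ R, Inc p l).card ≤
        L.card.choose r := by
      exact_mod_cast card_filter_exists_mem_powersetCard_le L (fun l => Inc p l) r hr (hdeg p hp)
    have h3 : (r : ℝ) * L.card.choose (r + 1) ≤ L.card * L.card.choose r := by
      have h4 := Nat.choose_succ_right_eq L.card r
      have h5 : r * L.card.choose (r + 1) ≤ L.card * L.card.choose r :=
        calc r * L.card.choose (r + 1) ≤ L.card.choose (r + 1) * (r + 1) := by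
              rw [mul_comm]; gcongr; omega
          _ = L.card.choose r * (L.card - r) := h4
          _ ≤ L.card * L.card.choose r := by rw [mul_comm]; gcongr; omega
      exact_mod_cast h5
    have hm : (0 : ℝ) < L.card := by exact_mod_cast hm0
    simp only [B, Finset.sum_add_distrib, ← Finset.mul_sum, ← Finset.sum_div]
    rw [Finset.sum_boole]
    have h6 : (r : ℝ) * (∑ R ∈ L.powersetCard r, (conf R p : ℝ)) / (24 * L.card) ≤
        L.card.choose r / 4 := by
      rw [div_le_iff₀ (by positivity)]
      nlinarith [mul_le_mul_of_nonneg_left h1 (Nat.cast_nonneg (α := ℝ) r)]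
    linarith
  obtain ⟨R, hR, hRB⟩ : ∃ R ∈ L.powersetCard r, ∑ p ∈ P, w p * B R p ≤ (∑ p ∈ P, w p) / 2 := by
    refine Finset.exists_le_of_sum_le (Finset.powersetCard_nonempty.2 hrL) ?_
    rw [Finset.sum_comm, Finset.sum_const, Finset.card_powersetCard, nsmul_eq_mul,
      mul_div_assoc', Finset.mul_sum, Finset.sum_div]
    refine Finset.sum_le_sum fun p hp => ?_
    rw [← Finset.mul_sum]
    nlinarith [mul_le_mul_of_nonneg_left (hB p hp) (hw p hp)]
  have hRL := (Finset.mem_powersetCard.1 hR).1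
  have hRr := (Finset.mem_powersetCard.1 hR).2
  set G := P.filter fun p => (∀ l ∈ R, ¬ Inc p l) ∧ r * conf R p ≤ 24 * L.card with hG
  have hGP : G ⊆ P := Finset.filter_subset _ _
  refine ⟨G, hGP, ?_, ?_⟩
  · have hm : (0 : ℝ) < L.card := by exact_mod_cast hm0
    have hB0 : ∀ p, 0 ≤ B R p := fun p => by
      simp only [B]
      have : (0 : ℝ) ≤ if ∃ l ∈ R, Inc p l then 1 else 0 := by split_ifs <;> norm_num
      positivity
    have h1 : ∑ p ∈ P \ G, w p ≤ ∑ p ∈ P, w p * B R p := by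
      refine le_trans (Finset.sum_le_sum fun p hp => ?_)
        (Finset.sum_le_sum_of_subset_of_nonneg Finset.sdiff_subset fun p hp _ =>
          mul_nonneg (hw p hp) (hB0 p))
      rw [Finset.mem_sdiff] at hp
      refine le_mul_of_one_le_right (hw p hp.1) ?_
      by_cases hinc : ∃ l ∈ R, Inc p l
      · simp only [B, if_pos hinc]
        have : (0 : ℝ) ≤ r * conf R p / (24 * L.card) := by positivity
        linarith
      · have h2 : 24 * L.card < r * conf R p := by
          by_contra h
          exact hp.2 (Finset.mem_filter.2 ⟨hp.1, fun l hl hi => hinc ⟨l, hl, hi⟩, not_lt.1 h⟩)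
        have h3 : (24 : ℝ) * L.card < r * conf R p := by exact_mod_cast h2
        simp only [B, if_neg hinc]
        rw [mul_zero, add_zero, le_div_iff₀ (by positivity)]
        linarith
    have h2 := Finset.sum_sdiff (f := w) hGP
    linarith
  have hP : ∀ p ∈ G, ∀ l ∈ R ∪ Z, ¬ Inc p l := by
    intro p hp l hl
    rw [hG, Finset.mem_filter] at hp
    rcases Finset.mem_union.1 hl with h | h
    · exact hp.2.1 l h
    · have := abs_lt.1 (hH p hp.1)
      simp only [hZ, Finset.mem_insert, Finset.mem_singleton] at h
      unfold Inc
      rcases h with rfl | rfl <;> simp <;> intro h <;> linarith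
  have hex : ∀ p ∈ G, ∃ a b c d, LineAbove (R ∪ Z) p a ∧ LineBelow (R ∪ Z) p b ∧
      IsLeftWall M (R ∪ Z) a p.1 c ∧ IsLeftWall M (R ∪ Z) b p.1 d := by
    intro p hp
    have hp' := abs_lt.1 (hH p (hGP hp))
    obtain ⟨a, ha⟩ := exists_lineAbove (R := R ∪ Z) (p := p) (z := (0, -H)) (by simp [hZ])
      (by simpa [height] using hp'.2)
    obtain ⟨b, hb⟩ := exists_lineBelow (R := R ∪ Z) (p := p) (z := (0, H)) (by simp [hZ])
      (by simpa [height] using hp'.1)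
    obtain ⟨c, hc⟩ := exists_isLeftWall ha.1 (hM p (hGP hp))
    obtain ⟨d, hd⟩ := exists_isLeftWall hb.1 (hM p (hGP hp))
    exact ⟨a, b, c, d, ha, hb, hc, hd⟩
  choose! a b c d ha hb hc hd using hex
  let κ : ℝ × ℝ → Bool × (ℝ × ℝ) × (ℝ × ℝ) := fun p =>
    if wall M (d p) (b p) ≤ wall M (c p) (a p) then (true, a p, c p) else (false, b p, d p)
  have hκ : ∀ p ∈ G, ∀ q ∈ G, κ p = κ q → q ∈ cell M (R ∪ Z) p := by
    intro p hp q hq h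
    simp only [κ] at h
    split_ifs at h with h1 h2 h2
    · simp only [Prod.mk.injEq, true_and] at h
      have ha' := ha q hq
      have hc' := hc q hq
      rw [← h.1, ← h.2] at h2
      rw [← h.1] at ha' hc'
      rw [← h.2] at hc'
      exact mem_cell_of_top (hP p hp) (hP q hq) (ha p hp) ha' (hb p hp) (hb q hq) (hc p hp) hc'
        (hd p hp) (hd q hq) h1 h2
    · simp at h
    · simp at h
    · simp only [Prod.mk.injEq, true_and] at h
      have hb' := hb q hq
      have hd' := hd q hq
      rw [← h.1, ← h.2] at h2
      rw [← h.1] at hb' hd'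
      rw [← h.2] at hd'
      exact mem_cell_of_bot (hP p hp) (hP q hq) (hb p hp) hb' (ha p hp) (ha q hq) (hd p hp) hd'
        (hc p hp) (hc q hq) (not_le.1 h1).le (not_le.1 h2).le
  refine ⟨κ, Finset.univ ×ˢ (R ∪ Z) ×ˢ (R ∪ Z), fun p hp => ?_, ?_, fun k => ?_⟩
  · simp only [κ]
    split_ifs
    · simp only [Finset.mem_product, Finset.mem_univ, true_and]
      exact ⟨(ha p hp).1, (hc p hp).1⟩
    · simp only [Finset.mem_product, Finset.mem_univ, true_and]
      exact ⟨(hb p hp).1, (hd p hp).1⟩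
  · have h1 : (R ∪ Z).card ≤ r + 2 :=
      (Finset.card_union_le _ _).trans (add_le_add hRr.le Finset.card_le_two)
    rw [Finset.card_product, Finset.card_product, Finset.card_univ, Fintype.card_bool]
    nlinarith
  · rcases (G.filter fun p => κ p = k).eq_empty_or_nonempty with h | ⟨p₀, h⟩
    · have h0 : L.filter (fun l => ∃ p ∈ G, κ p = k ∧ Inc p l) = ∅ := by
        rw [Finset.filter_eq_empty_iff]
        rintro l - ⟨p, hp, hk, -⟩
        exact (Finset.filter_eq_empty_iff.1 h hp) hk
      rw [h0]
      simp
    · rw [Finset.mem_filter] at h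
      have h1 : (L.filter fun l => ∃ p ∈ G, κ p = k ∧ Inc p l).card ≤
          (L.filter fun l => Inc p₀ l).card + conf R p₀ := by
        refine (Finset.card_le_card ?_).trans (Finset.card_union_le _ _)
        intro l hl
        simp only [Finset.mem_filter, Finset.mem_union] at hl ⊢
        obtain ⟨hlL, p, hp, hk, hpl⟩ := hl
        by_cases h0 : Inc p₀ l
        · exact Or.inl ⟨hlL, h0⟩
        · exact Or.inr ⟨hlL, h0, p, hκ p₀ h.1 p hp (h.2.trans hk.symm), hpl⟩
      have h2 := hdeg p₀ (hGP h.1)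
      have h3 := (Finset.mem_filter.1 h.1).2.2
      have h4 := Nat.mul_le_mul_left r h1
      rw [mul_add] at h4
      linarith

open Classical in
/-- The number of lines of `L` through `p`. -/
def incDeg (L : Finset (ℝ × ℝ)) (p : ℝ × ℝ) : ℕ := (L.filter fun l => Inc p l).card

/-- The number of incidences between `P` and `L`. -/
def incCount (P L : Finset (ℝ × ℝ)) : ℕ := ∑ p ∈ P, incDeg L p

theorem incCount_comm (P L : Finset (ℝ × ℝ)) : incCount P L = incCount L P := by
  classical
  unfold incCount incDeg
  simp only [Finset.card_filter]
  rw [Finset.sum_comm]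
  simp only [inc_comm]

open Classical in
theorem incDeg_mono {L L' : Finset (ℝ × ℝ)} (h : L ⊆ L') (p : ℝ × ℝ) : incDeg L p ≤ incDeg L' p :=
  Finset.card_le_card (Finset.filter_subset_filter _ h)

open Classical in
theorem incCount_sdiff {P P' : Finset (ℝ × ℝ)} (h : P ⊆ P') (L : Finset (ℝ × ℝ)) :
    incCount (P' \ P) L + incCount P L = incCount P' L := Finset.sum_sdiff h

theorem sum_incDeg_sq_le (P L : Finset (ℝ × ℝ)) :
    ∑ p ∈ P, incDeg L p ^ 2 ≤ incCount P L + L.card ^ 2 := by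
  classical
  have h1 : ∑ p ∈ P, (L.filter fun l => Inc p l).offDiag.card ≤ L.card ^ 2 := by
    rw [← Finset.card_biUnion]
    · refine (Finset.card_le_card (t := L ×ˢ L) ?_).trans (by rw [Finset.card_product, sq])
      intro x hx
      simp only [Finset.mem_biUnion, Finset.mem_offDiag, Finset.mem_filter] at hx
      obtain ⟨p, -, h1, h2, -⟩ := hx
      exact Finset.mem_product.2 ⟨h1.1, h2.1⟩
    · intro p _ q _ hpq
      refine Finset.disjoint_left.2 fun x hx hx' => hpq ?_
      simp only [Finset.mem_offDiag, Finset.mem_filter] at hx hx'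
      exact Inc.eq_of_ne hx.1.2.symm hx.2.1.2.symm hx'.1.2.symm hx'.2.1.2.symm hx.2.2
  refine le_trans (le_of_eq ?_) (Nat.add_le_add_left h1 (incCount P L))
  unfold incCount
  rw [← Finset.sum_add_distrib]
  refine Finset.sum_congr rfl fun p _ => ?_
  rw [Finset.offDiag_card, incDeg, sq]
  have := Nat.le_mul_self (L.filter fun l => Inc p l).card
  omega

theorem incCount_le (P L : Finset (ℝ × ℝ)) :
    (incCount P L : ℝ) ≤ P.card + √P.card * L.card := by
  have h1 : ((incCount P L : ℝ)) ^ 2 ≤ P.card * (incCount P L + L.card ^ 2) := by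
    have h2 : (∑ p ∈ P, (incDeg L p : ℝ)) ^ 2 ≤ P.card * ∑ p ∈ P, (incDeg L p : ℝ) ^ 2 :=
      sq_sum_le_card_mul_sum_sq
    have h3 : (∑ p ∈ P, (incDeg L p : ℝ) ^ 2) ≤ incCount P L + L.card ^ 2 := by
      exact_mod_cast sum_incDeg_sq_le P L
    refine le_trans ?_ (mul_le_mul_of_nonneg_left h3 (Nat.cast_nonneg _))
    simpa [incCount] using h2
  by_contra! h
  have hs : √(P.card : ℝ) ^ 2 = P.card := Real.sq_sqrt (Nat.cast_nonneg _)
  have h0 : 0 ≤ √(P.card : ℝ) * L.card := by positivity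
  have h4 : (0 : ℝ) ≤ P.card := Nat.cast_nonneg _
  have h5 : (√(P.card : ℝ) * L.card) ^ 2 = P.card * (L.card : ℝ) ^ 2 := by rw [mul_pow, hs]
  nlinarith

theorem incCount_le' (P L : Finset (ℝ × ℝ)) :
    (incCount P L : ℝ) ≤ L.card + √L.card * P.card := by
  rw [incCount_comm]; exact incCount_le L P

open Classical in
theorem incCount_rich_le (P L : Finset (ℝ × ℝ)) :
    incCount (P.filter fun p => 2 * √L.card < incDeg L p) L ≤ 2 * L.card := by
  set Q := P.filter fun p => 2 * √L.card < incDeg L p with hQ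
  have h1 : 2 * √L.card * Q.card ≤ incCount Q L := by
    rw [incCount, Nat.cast_sum, mul_comm, ← nsmul_eq_mul, ← Finset.sum_const]
    exact Finset.sum_le_sum fun p hp => (Finset.mem_filter.1 hp).2.le
  have h2 := incCount_le' Q L
  have : (incCount Q L : ℝ) ≤ 2 * L.card := by linarith
  exact_mod_cast this

theorem exists_cube_eq {y : ℝ} (hy : 0 ≤ y) : ∃ k : ℝ, 0 ≤ k ∧ k ^ 3 = y :=
  ⟨y ^ (3⁻¹ : ℝ), by positivity, by
    rw [← Real.rpow_natCast, ← Real.rpow_mul hy]; norm_num⟩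

open Classical in
/-- The points of `G` in the cellPoints of colour `k`. -/
def cellPoints {ι : Type*} (G : Finset (ℝ × ℝ)) (κ : ℝ × ℝ → ι) (k : ι) : Finset (ℝ × ℝ) :=
  G.filter fun p => κ p = k

open Classical in
/-- The lines of `L` through some point of `Q`. -/
def linesMeeting (L Q : Finset (ℝ × ℝ)) : Finset (ℝ × ℝ) := L.filter fun l => ∃ p ∈ Q, Inc p l

theorem linesMeeting_subset (L Q : Finset (ℝ × ℝ)) : linesMeeting L Q ⊆ L := by
  classical
  exact Finset.filter_subset _ _

theorem cellPoints_subset {ι : Type*} (G : Finset (ℝ × ℝ)) (κ : ℝ × ℝ → ι) (k : ι) :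
    cellPoints G κ k ⊆ G := by
  classical
  exact Finset.filter_subset _ _

theorem incCount_linesMeeting {L Q : Finset (ℝ × ℝ)} :
    incCount Q (linesMeeting L Q) = incCount Q L := by
  classical
  refine Finset.sum_congr rfl fun p hp => ?_
  unfold incDeg linesMeeting
  congr 1
  ext l
  simp only [Finset.mem_filter]
  exact ⟨fun h => ⟨h.1.1, h.2⟩, fun h => ⟨⟨h.1, p, hp, h.2⟩, h.2⟩⟩

theorem sum_cellPoints {ι : Type*} {G : Finset (ℝ × ℝ)} {κ : ℝ × ℝ → ι} {K : Finset ι}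
    (hκ : ∀ p ∈ G, κ p ∈ K) (f : ℝ × ℝ → ℕ) :
    ∑ k ∈ K, ∑ p ∈ cellPoints G κ k, f p = ∑ p ∈ G, f p := by
  classical
  exact Finset.sum_fiberwise_of_maps_to hκ f

theorem sum_card_cellPoints {ι : Type*} {G : Finset (ℝ × ℝ)} {κ : ℝ × ℝ → ι} {K : Finset ι}
    (hκ : ∀ p ∈ G, κ p ∈ K) : ∑ k ∈ K, (cellPoints G κ k).card = G.card := by
  simpa using sum_cellPoints hκ fun _ => 1

open Classical in
theorem exists_cells (P L : Finset (ℝ × ℝ)) (w : ℝ × ℝ → ℝ) (hw : ∀ p ∈ P, 0 ≤ w p) (r : ℕ)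
    (hr : 1 ≤ r) (hrL : r ≤ L.card) (hdeg : ∀ p ∈ P, 8 * r * incDeg L p ≤ L.card) :
    ∃ G ⊆ P, ∑ p ∈ P, w p ≤ 2 * ∑ p ∈ G, w p ∧ ∃ (ι : Type) (κ : ℝ × ℝ → ι) (K : Finset ι),
      (∀ p ∈ G, κ p ∈ K) ∧ K.card ≤ 18 * r ^ 2 ∧
      ∀ k, r * (linesMeeting L (cellPoints G κ k)).card ≤ 25 * L.card := by
  obtain ⟨G, hG, hw, κ, K, hκ, hK, hM⟩ := exists_partition P L w hw r hr hrL hdeg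
  refine ⟨G, hG, hw, _, κ, K, hκ, hK, fun k => le_of_eq_of_le ?_ (hM k)⟩
  congr 2
  ext l
  simp only [linesMeeting, cellPoints, Finset.mem_filter, and_assoc]

theorem incCount_le_of_cells {ι : Type*} {G L : Finset (ℝ × ℝ)} {κ : ℝ × ℝ → ι} {K : Finset ι}
    (hκ : ∀ p ∈ G, κ p ∈ K) {M : ℝ} (hM : ∀ k, ((linesMeeting L (cellPoints G κ k)).card : ℝ) ≤ M) :
    (incCount G L : ℝ) ≤ K.card * M + √M * G.card := by
  rw [incCount, ← sum_cellPoints hκ, ← sum_card_cellPoints hκ]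
  push_cast
  rw [Finset.mul_sum, ← nsmul_eq_mul, ← Finset.sum_const, ← Finset.sum_add_distrib]
  refine Finset.sum_le_sum fun k _ => ?_
  have h1 := incCount_le' (cellPoints G κ k) (linesMeeting L (cellPoints G κ k))
  rw [incCount_linesMeeting, incCount] at h1
  push_cast at h1
  have h2 := Real.sqrt_le_sqrt (hM k)
  have := hM k
  refine h1.trans ?_
  gcongr

open Classical in
theorem incCount_le_of_card_le {P L : Finset (ℝ × ℝ)} (h : P.card ≤ L.card) {y : ℝ} (hy : 0 ≤ y)
    (hy3 : y ^ 3 = (P.card : ℝ) ^ 2 * (L.card : ℝ) ^ 2) :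
    (incCount P L : ℝ) ≤ 120 * (y + P.card + L.card) := by
  rcases Finset.eq_empty_or_nonempty P with rfl | hP
  · simp [incCount]; positivity
  have hn : 1 ≤ P.card := hP.card_pos
  have hm : 1 ≤ L.card := hn.trans h
  obtain ⟨n, hnd⟩ : ∃ n : ℝ, n = P.card := ⟨_, rfl⟩
  obtain ⟨m, hmd⟩ : ∃ m : ℝ, m = L.card := ⟨_, rfl⟩
  rw [← hnd, ← hmd] at hy3 ⊢
  have hn' : 1 ≤ n := by rw [hnd]; exact_mod_cast hn
  have hm' : 1 ≤ m := by rw [hmd]; exact_mod_cast hm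
  have hnm : n ≤ m := by rw [hnd, hmd]; exact_mod_cast h
  obtain ⟨k, rfl⟩ : ∃ k, y = m * k := ⟨y / m, by field_simp⟩
  have hk0 : 0 ≤ k := nonneg_of_mul_nonneg_right hy (by linarith)
  have hk3 : k ^ 3 * m = n ^ 2 := by
    have : m ^ 2 * (k ^ 3 * m) = m ^ 2 * n ^ 2 := by linear_combination hy3
    exact mul_left_cancel₀ (by positivity) this
  set s := √m with hs
  have hs2 : s ^ 2 = m := Real.sq_sqrt (by linarith)
  have hs0 : 0 ≤ s := Real.sqrt_nonneg _
  rcases lt_or_ge k 16 with hk | hk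
  · have h1 := incCount_le' P L
    rw [← hmd, ← hnd, ← hs] at h1
    have h2 : n ≤ 64 * s := by
      refine abs_le_of_sq_le_sq' ?_ (by positivity) |>.2
      have : k ^ 3 ≤ 16 ^ 3 := pow_le_pow_left₀ hk0 hk.le 3
      nlinarith
    nlinarith
  have hkm : k ^ 3 ≤ m := by nlinarith
  set r := ⌊k / 16⌋₊ with hr
  have hr1 : 1 ≤ r := Nat.le_floor (by push_cast; linarith)
  have hrk : (r : ℝ) ≤ k / 16 := Nat.floor_le (by positivity)
  have hkr : k / 32 ≤ r := by
    have h1 : k / 16 < r + 1 := Nat.lt_floor_add_one _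
    have h2 : (1 : ℝ) ≤ r := by exact_mod_cast hr1
    linarith
  have hks : k ≤ s := abs_le_of_sq_le_sq' (by nlinarith [sq_nonneg k]) hs0 |>.2
  set Q := P.filter fun p => 2 * √(L.card : ℝ) < incDeg L p with hQ
  have hrich : incCount Q L ≤ 2 * L.card := incCount_rich_le P L
  have hQP : Q ⊆ P := Finset.filter_subset _ _
  have hdeg : ∀ p ∈ P \ Q, 8 * r * incDeg L p ≤ L.card := by
    intro p hp
    have h1 : (incDeg L p : ℝ) ≤ 2 * s := by
      by_contra! h2
      refine (Finset.mem_sdiff.1 hp).2 (Finset.mem_filter.2 ⟨(Finset.mem_sdiff.1 hp).1, ?_⟩)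
      rwa [← hmd]
    have h2 : (8 * r * incDeg L p : ℝ) ≤ m := by
      calc (8 * r * incDeg L p : ℝ) ≤ 8 * (k / 16) * (2 * s) := by gcongr
        _ = k * s := by ring
        _ ≤ s * s := by gcongr
        _ = m := by rw [← hs2]; ring
    rw [hmd] at h2
    exact_mod_cast h2
  have hrL : r ≤ L.card := by
    have : (r : ℝ) ≤ m := by nlinarith [sq_nonneg k]
    rw [hmd] at this
    exact_mod_cast this
  obtain ⟨G, hG, hw, ι, κ, K, hκ, hK, hM⟩ := exists_cells (P \ Q) L (fun p => (incDeg L p : ℝ))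
    (fun _ _ => by positivity) r hr1 hrL hdeg
  have hr0 : (0 : ℝ) < r := by exact_mod_cast hr1
  have hcell : (incCount G L : ℝ) ≤ 450 * m * r + 5 * √(m / r) * n := by
    have h1 : ∀ c, ((linesMeeting L (cellPoints G κ c)).card : ℝ) ≤ 5 ^ 2 * (m / r) := by
      intro c
      rw [← mul_div_assoc, le_div_iff₀ hr0, mul_comm, hmd]
      have := hM c
      norm_num
      exact_mod_cast this
    refine (incCount_le_of_cells hκ h1).trans ?_
    rw [Real.sqrt_mul (by positivity), Real.sqrt_sq (by norm_num)]
    have h4 : (K.card : ℝ) ≤ 18 * r ^ 2 := by exact_mod_cast hK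
    have h5 : (G.card : ℝ) ≤ n := by
      rw [hnd]; exact_mod_cast Finset.card_le_card (hG.trans Finset.sdiff_subset)
    have h6 : (K.card : ℝ) * (5 ^ 2 * (m / r)) ≤ 450 * m * r := by
      calc (K.card : ℝ) * (5 ^ 2 * (m / r)) ≤ 18 * r ^ 2 * (5 ^ 2 * (m / r)) := by gcongr
        _ = 450 * m * r := by field_simp; ring
    gcongr
  have hsq : √(m / r) * n ≤ 6 * (m * k) := by
    refine abs_le_of_sq_le_sq' ?_ (by positivity) |>.2
    rw [mul_pow, Real.sq_sqrt (by positivity), div_mul_eq_mul_div, div_le_iff₀ hr0, ← hk3]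
    have : 0 ≤ m ^ 2 * k ^ 2 := by positivity
    nlinarith
  have hsplit := incCount_sdiff hQP L
  have hw' : (incCount (P \ Q) L : ℝ) ≤ 2 * incCount G L := by
    simpa [incCount] using hw
  have hrich' : (incCount Q L : ℝ) ≤ 2 * m := by rw [hmd]; exact_mod_cast hrich
  have hsplit' : (incCount (P \ Q) L : ℝ) + incCount Q L = incCount P L := by
    exact_mod_cast hsplit
  have h9 : m * r ≤ m * (k / 16) := by gcongr
  have h10 : 0 ≤ m * k := by positivity
  linarith

/-- The Szemerédi–Trotter bound. -/
theorem incCount_le_szemerediTrotter (P L : Finset (ℝ × ℝ)) {x : ℝ} (hx : 0 ≤ x)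
    (hx3 : (P.card : ℝ) ^ 2 * (L.card : ℝ) ^ 2 ≤ x ^ 3) :
    (incCount P L : ℝ) ≤ 120 * (x + P.card + L.card) := by
  obtain ⟨y, hy, hy3⟩ := exists_cube_eq (y := (P.card : ℝ) ^ 2 * (L.card : ℝ) ^ 2) (by positivity)
  have hyx : y ≤ x := le_of_pow_le_pow_left₀ three_ne_zero hx (hy3.le.trans hx3)
  rcases le_total P.card L.card with h | h
  · linarith [incCount_le_of_card_le h hy hy3]
  · rw [incCount_comm]
    linarith [incCount_le_of_card_le h hy (hy3.trans (mul_comm _ _))]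

theorem IsMotion.symm {A B : Finset (ℝ × ℝ)} {u w : ℝ × ℝ → ℝ × ℝ} (h : IsMotion A B u w) :
    IsMotion B A w u := fun p hp l hl hi => by
  have := h l hl p hp hi.symm
  linarith

theorem RigidLE.symm {A B : Finset (ℝ × ℝ)} {R : ℕ} (h : RigidLE A B R) : RigidLE B A R := by
  intro u w huw
  obtain ⟨c, hc, h1, h2⟩ := h w u fun j => (huw j).symm
  exact ⟨c, hc, h2, h1⟩

/-- Adding a point on two lines of a configuration creates no new infinitesimal motions. -/
theorem RigidLE.insert_point {A B : Finset (ℝ × ℝ)} {R : ℕ} [DecidableEq (ℝ × ℝ)]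
    (h : RigidLE A B R) {p : ℝ × ℝ} (hp : 2 ≤ incDeg B p) : RigidLE (insert p A) B R := by
  classical
  obtain ⟨l, hl, k, hk, hlk⟩ := Finset.one_lt_card.1 hp
  rw [Finset.mem_filter] at hl hk
  intro u w huw
  obtain ⟨c, hc, h1, h2⟩ := h u w fun j q hq => huw j q (Finset.mem_insert_of_mem hq)
  refine ⟨c, hc, fun q hq => ?_, h2⟩
  rcases Finset.mem_insert.1 hq with rfl | hq
  swap
  · exact h1 q hq
  have key : ∀ l ∈ B, Inc q l → (∑ j, c j • u j q).2 = (∑ j, c j • u j q).1 * l.1 := by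
    intro l hl hi
    have h3 := h2 l hl
    have h4 : ∑ j, c j * (w j l).1 = 0 := by simpa [Prod.fst_sum] using congrArg Prod.fst h3
    have h5 : ∑ j, c j * (w j l).2 = 0 := by simpa [Prod.snd_sum] using congrArg Prod.snd h3
    have h6 : ∀ j, c j * (u j q).2 + c j * (w j l).2 =
        c j * (u j q).1 * l.1 + q.1 * (c j * (w j l).1) := fun j => by
      linear_combination c j * huw j q (Finset.mem_insert_self _ _) l hl hi
    have h7 := Finset.sum_congr (rfl : Finset.univ = Finset.univ) fun j _ => h6 j
    rw [Finset.sum_add_distrib, Finset.sum_add_distrib, ← Finset.mul_sum, ← Finset.sum_mul, h4,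
      h5] at h7
    simpa [Prod.fst_sum, Prod.snd_sum] using h7
  have hx := hl.2.symm.fst_ne hk.2.symm hlk
  have e1 := key l hl.1 hl.2
  have e2 := key k hk.1 hk.2
  have e3 : (∑ j, c j • u j q).1 = 0 := by
    have : (∑ j, c j • u j q).1 * (l.1 - k.1) = 0 := by linarith
    exact (mul_eq_zero.1 this).resolve_right (sub_ne_zero.2 hx)
  exact Prod.ext e3 (by rw [e1, e3]; simp)

/-- A rigid subconfiguration can be enlarged until every remaining point is on at most one of its
lines and every remaining line has at most one of its points. -/
theorem RigidLE.exists_closure {A₀ B₀ P L : Finset (ℝ × ℝ)} {R : ℕ} (h : RigidLE A₀ B₀ R)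
    (hA : A₀ ⊆ P) (hB : B₀ ⊆ L) :
    ∃ A B, A₀ ⊆ A ∧ A ⊆ P ∧ B₀ ⊆ B ∧ B ⊆ L ∧ RigidLE A B R ∧
      (∀ p ∈ P, p ∉ A → incDeg B p ≤ 1) ∧ ∀ l ∈ L, l ∉ B → incDeg A l ≤ 1 := by
  classical
  obtain ⟨X, hX, hmax⟩ := Finset.exists_max_image
    ((P.powerset ×ˢ L.powerset).filter fun X => A₀ ⊆ X.1 ∧ B₀ ⊆ X.2 ∧ RigidLE X.1 X.2 R)
    (fun X => X.1.card + X.2.card)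
    ⟨(A₀, B₀), by simp [hA, hB, h]⟩
  simp only [Finset.mem_filter, Finset.mem_product, Finset.mem_powerset] at hX hmax
  obtain ⟨⟨h1, h2⟩, h3, h4, h5⟩ := hX
  refine ⟨X.1, X.2, h3, h1, h4, h2, h5, fun p hp hpA => ?_, fun l hl hlB => ?_⟩
  · by_contra! h6
    have := hmax (insert p X.1, X.2) ⟨⟨Finset.insert_subset hp h1, h2⟩,
      h3.trans (Finset.subset_insert _ _), h4, h5.insert_point h6⟩
    simp [Finset.card_insert_of_notMem hpA] at this
  · by_contra! h6
    have := hmax (X.1, insert l X.2) ⟨⟨h1, Finset.insert_subset hl h2⟩, h3,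
      h4.trans (Finset.subset_insert _ _), (h5.symm.insert_point h6).symm⟩
    simp [Finset.card_insert_of_notMem hlB] at this

theorem incCount_closure_ge {P A B : Finset (ℝ × ℝ)} {t : ℝ} (hA : A ⊆ P)
    (hP : ∀ l ∈ B, 2 * t ≤ incDeg P l) (hcl : ∀ p ∈ P, p ∉ A → incDeg B p ≤ 1)
    (hPB : P.card ≤ t * B.card) : t * B.card ≤ incCount A B := by
  classical
  have h1 : (incCount (P \ A) B : ℝ) ≤ P.card := by
    have : incCount (P \ A) B ≤ ∑ p ∈ P \ A, 1 := Finset.sum_le_sum fun p hp =>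
      hcl p (Finset.mem_sdiff.1 hp).1 (Finset.mem_sdiff.1 hp).2
    rw [← Finset.card_eq_sum_ones] at this
    exact_mod_cast this.trans (Finset.card_le_card Finset.sdiff_subset)
  have h2 : (incCount (P \ A) B : ℝ) + incCount A B = incCount P B := by
    exact_mod_cast incCount_sdiff hA B
  have h3 : 2 * t * B.card ≤ incCount P B := by
    rw [incCount_comm, incCount, Nat.cast_sum, mul_comm, ← nsmul_eq_mul, ← Finset.sum_const]
    exact Finset.sum_le_sum hP
  linarith

theorem card_ge_of_incCount_ge {A B : Finset (ℝ × ℝ)} {t : ℝ} (ht : 1 ≤ t)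
    (h : 360 * t * B.card ≤ incCount A B) :
    t * B.card ≤ A.card ∨ t ^ 3 * B.card ≤ (A.card : ℝ) ^ 2 := by
  obtain ⟨x, hx, hx3⟩ := exists_cube_eq (y := (A.card : ℝ) ^ 2 * (B.card : ℝ) ^ 2) (by positivity)
  have h1 := incCount_le_szemerediTrotter A B hx hx3.ge
  have hB0 : (0 : ℝ) ≤ B.card := Nat.cast_nonneg _
  rcases hB0.eq_or_lt with hB | hB
  · left; rw [← hB]; simp
  rcases le_or_gt (t * B.card) A.card with h2 | h2
  · exact .inl h2
  have h3 : t * B.card ≤ x := by nlinarith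
  have h4 : (t * B.card) ^ 3 ≤ x ^ 3 := pow_le_pow_left₀ (by positivity) h3 3
  right
  rw [hx3] at h4
  refine le_of_mul_le_mul_right ?_ (pow_pos hB 2)
  linarith

theorem growth_bound {a b β s t : ℝ} (hβ : 0 < β) (hβ1 : β ≤ 1) (hs : 1 ≤ s) (ht : 1 ≤ t)
    (ha : 0 < a) (hb : 0 < b) (hst : 1 < β * s * (β * t))
    (h1 : β * s * b ≤ a ∨ (β * s) ^ 3 * b ≤ a ^ 2)
    (h2 : β * t * a ≤ b ∨ (β * t) ^ 3 * a ≤ b ^ 2) : β ^ 5 * (s ^ 2 * t) ≤ a := by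
  have hS : 0 < β * s := by positivity
  have hT : 0 < β * t := by positivity
  have hb4 : β ^ 5 ≤ β ^ 4 := pow_le_pow_of_le_one hβ.le hβ1 (by norm_num)
  have hb3 : β ^ 5 ≤ β ^ 3 := pow_le_pow_of_le_one hβ.le hβ1 (by norm_num)
  rcases h1 with h1 | h1 <;> rcases h2 with h2 | h2
  · exfalso
    have : β * s * (β * t * a) ≤ a := (mul_le_mul_of_nonneg_left h2 hS.le).trans h1
    nlinarith
  · have h3 : (β * t) ^ 3 * (β * s * b) ≤ b ^ 2 :=
      (mul_le_mul_of_nonneg_left h1 (by positivity)).trans h2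
    have h4 : (β * t) ^ 3 * (β * s) ≤ b := le_of_mul_le_mul_right (by linarith) hb
    have h5 : β * s * ((β * t) ^ 3 * (β * s)) ≤ a := (mul_le_mul_of_nonneg_left h4 hS.le).trans h1
    refine le_trans ?_ h5
    have : 1 ≤ t ^ 2 := one_le_pow₀ ht
    calc β ^ 5 * (s ^ 2 * t) = β ^ 5 * (s ^ 2 * t) * 1 := by ring
      _ ≤ β ^ 5 * (s ^ 2 * t) * t ^ 2 := by gcongr
      _ = _ := by ring
  · have h3 : (β * s) ^ 3 * (β * t * a) ≤ a ^ 2 :=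
      (mul_le_mul_of_nonneg_left h2 (by positivity)).trans h1
    have h4 : (β * s) ^ 3 * (β * t) ≤ a := le_of_mul_le_mul_right (by linarith) ha
    refine le_trans ?_ h4
    calc β ^ 5 * (s ^ 2 * t) ≤ β ^ 4 * (s ^ 2 * t) * 1 := by rw [mul_one]; gcongr
      _ ≤ β ^ 4 * (s ^ 2 * t) * s := by gcongr
      _ = _ := by ring
  · have h3 : ((β * s) ^ 3 * b) ^ 2 ≤ (a ^ 2) ^ 2 := pow_le_pow_left₀ (by positivity) h1 2
    have h4 : (β * s) ^ 6 * ((β * t) ^ 3 * a) ≤ a ^ 4 := by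
      refine (mul_le_mul_of_nonneg_left h2 (by positivity)).trans (le_trans (le_of_eq ?_)
        (h3.trans (le_of_eq ?_))) <;> ring
    have h5 : (β ^ 3 * (s ^ 2 * t)) ^ 3 ≤ a ^ 3 := by
      refine le_of_mul_le_mul_right (le_trans (le_of_eq ?_) (h4.trans (le_of_eq ?_))) ha <;> ring
    have h6 : β ^ 3 * (s ^ 2 * t) ≤ a := le_of_pow_le_pow_left₀ three_ne_zero ha.le h5
    refine le_trans ?_ h6
    gcongr

/-- In a configuration with `s²t` points and `t²s` lines, all of them rich, a closed
subconfiguration with enough lines contains a positive proportion of the points and lines. -/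
theorem card_closure_ge {P L A B : Finset (ℝ × ℝ)} {α s t : ℝ} (hα : 0 < α) (hα1 : α ≤ 1)
    (hst : s ≤ t) (hs : 2 ≤ α * (α / 720) ^ 3 * s)
    (hPc : P.card ≤ s ^ 2 * t) (hLc : L.card ≤ t ^ 2 * s) (hA : A ⊆ P) (hB : B ⊆ L)
    (hP : ∀ p ∈ P, α * t ≤ incDeg L p) (hL : ∀ l ∈ L, α * s ≤ incDeg P l)
    (hclP : ∀ p ∈ P, p ∉ A → incDeg B p ≤ 1) (hclL : ∀ l ∈ L, l ∉ B → incDeg A l ≤ 1)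
    (hBc : 2 * t ^ 2 ≤ α * B.card) :
    (α / 720) ^ 5 * (s ^ 2 * t) ≤ A.card ∧ (α / 720) ^ 5 * (t ^ 2 * s) ≤ B.card := by
  obtain ⟨β, hβ⟩ : ∃ β, β = α / 720 := ⟨_, rfl⟩
  rw [← hβ] at hs ⊢
  have hαβ : α = 720 * β := by rw [hβ]; ring
  have hβ0 : 0 < β := by linarith
  have hβ1 : β ≤ 1 := by linarith
  have hs0 : 0 < s := by
    by_contra! h
    have : α * β ^ 3 * s ≤ 0 := mul_nonpos_of_nonneg_of_nonpos (by positivity) h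
    linarith
  have ht0 : 0 < t := hs0.trans_le hst
  have hβs : 2 ≤ β * s := by
    refine hs.trans ?_
    have : α * β ^ 2 ≤ 1 := mul_le_one₀ hα1 (by positivity) (pow_le_one₀ hβ0.le hβ1)
    calc α * β ^ 3 * s = α * β ^ 2 * (β * s) := by ring
      _ ≤ 1 * (β * s) := by gcongr
      _ = β * s := one_mul _
  have hβt : 2 ≤ β * t := hβs.trans (by gcongr)
  have hs1 : 1 ≤ s := by nlinarith
  have ht1 : 1 ≤ t := hs1.trans hst
  have hAB : α / 2 * s * B.card ≤ incCount A B := by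
    refine incCount_closure_ge hA (fun l hl => ?_) hclP (hPc.trans ?_)
    · linarith [hL l (hB hl)]
    · calc s ^ 2 * t = s * (s * t) := by ring
        _ ≤ s * (t * t) := by gcongr
        _ = s / 2 * (2 * t ^ 2) := by ring
        _ ≤ s / 2 * (α * B.card) := by gcongr
        _ = _ := by ring
  have h1 := card_ge_of_incCount_ge (A := A) (B := B) (t := β * s) (by linarith) (by
    refine le_trans (le_of_eq ?_) hAB
    rw [hαβ]; ring)
  have hAc : 2 * (t * s) ≤ α * A.card := by
    rcases h1 with h1 | h1
    · calc 2 * (t * s) ≤ (β * t) * (t * s) := by gcongr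
        _ = β * s / 2 * (2 * t ^ 2) := by ring
        _ ≤ β * s / 2 * (α * B.card) := by gcongr
        _ = α / 2 * (β * s * B.card) := by ring
        _ ≤ α / 2 * A.card := by gcongr
        _ ≤ α * A.card := by nlinarith [show (0 : ℝ) ≤ A.card from Nat.cast_nonneg _]
    · have h0 : (0 : ℝ) ≤ α * A.card := mul_nonneg hα.le (Nat.cast_nonneg _)
      refine le_of_pow_le_pow_left₀ two_ne_zero h0 ?_
      calc (2 * (t * s)) ^ 2 = 2 * s ^ 2 * (2 * t ^ 2) := by ring
        _ ≤ (α * β ^ 3 * s) * s ^ 2 * (α * B.card) := by gcongr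
        _ = α ^ 2 * ((β * s) ^ 3 * B.card) := by ring
        _ ≤ α ^ 2 * (A.card : ℝ) ^ 2 := by gcongr
        _ = _ := by ring
  have hBA : α / 2 * t * A.card ≤ incCount B A := by
    refine incCount_closure_ge hB (fun p hp => ?_) hclL (hLc.trans ?_)
    · linarith [hP p (hA hp)]
    · calc t ^ 2 * s = t / 2 * (2 * (t * s)) := by ring
        _ ≤ t / 2 * (α * A.card) := by gcongr
        _ = _ := by ring
  have h2 := card_ge_of_incCount_ge (A := B) (B := A) (t := β * t) (by linarith) (by
    refine le_trans (le_of_eq ?_) hBA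
    rw [hαβ]; ring)
  have hA0 : (0 : ℝ) < A.card := by
    have : 0 < α * A.card := lt_of_lt_of_le (by positivity) hAc
    exact pos_of_mul_pos_right this hα.le
  have hB0 : (0 : ℝ) < B.card := by
    have : 0 < α * B.card := lt_of_lt_of_le (by positivity) hBc
    exact pos_of_mul_pos_right this hα.le
  exact ⟨growth_bound hβ0 hβ1 hs1 ht1 hA0 hB0 (by nlinarith) h1 h2,
    growth_bound hβ0 hβ1 ht1 hs1 hB0 hA0 (by nlinarith) h2 h1⟩

open Classical in
theorem exists_min_degree {α β : Type*} (D : ℕ) (T : β → Finset α) (Q : Finset α) (B : Finset β)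
    (hT : ∀ l ∈ B, T l ⊆ Q) :
    ∃ A ⊆ Q, ∃ B' ⊆ B, (∀ l ∈ B', T l ⊆ A) ∧ (∀ p ∈ A, D ≤ (B'.filter fun l => p ∈ T l).card) ∧
      B.card ≤ B'.card + D * Q.card := by
  induction Q using Finset.strongInduction generalizing B with
  | H Q ih =>
    by_cases h : ∀ p ∈ Q, D ≤ (B.filter fun l => p ∈ T l).card
    · exact ⟨Q, subset_rfl, B, subset_rfl, hT, h, Nat.le_add_right _ _⟩
    push Not at h
    obtain ⟨p, hp, hpD⟩ := h
    obtain ⟨A, hA, B', hB', h1, h2, h3⟩ := ih (Q.erase p) (Finset.erase_ssubset hp)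
      (B.filter fun l => p ∉ T l) fun l hl q hq => Finset.mem_erase.2
        ⟨fun h => (Finset.mem_filter.1 hl).2 (h ▸ hq), hT l (Finset.mem_filter.1 hl).1 hq⟩
    refine ⟨A, hA.trans (Finset.erase_subset _ _), B', hB'.trans (Finset.filter_subset _ _),
      h1, h2, ?_⟩
    have h4 := Finset.card_filter_add_card_filter_not (s := B) fun l => p ∈ T l
    have h5 := Finset.card_erase_add_one hp
    rw [← h5]
    linarith

open Classical in
/-- The lines of `L` through at least three points of `Q`. -/
def richLines (L Q : Finset (ℝ × ℝ)) : Finset (ℝ × ℝ) := L.filter fun l => 3 ≤ incDeg Q l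

theorem richLines_subset (L Q : Finset (ℝ × ℝ)) : richLines L Q ⊆ L := by
  classical
  exact Finset.filter_subset _ _

theorem exists_rigidLE_of_rich {Q L : Finset (ℝ × ℝ)} {D R : ℕ} (hD : 2 ≤ D)
    (hQ : 2 * D * Q.card ≤ (richLines L Q).card)
    (hR : ((richLines L Q).card : ℝ) < (R + 1) * (D / 20 : ℝ) ^ 2) :
    ∃ A ⊆ Q, ∃ B ⊆ L, RigidLE A B R ∧ (richLines L Q).card ≤ 2 * B.card := by
  classical
  have h : ∀ l, ∃ t : Finset (ℝ × ℝ), l ∈ richLines L Q →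
      t ⊆ Q ∧ t.card = 3 ∧ ∀ p ∈ t, Inc p l := by
    intro l
    by_cases hl : l ∈ richLines L Q
    swap
    · exact ⟨∅, fun h => absurd h hl⟩
    obtain ⟨t, ht, h3⟩ := Finset.exists_subset_card_eq (Finset.mem_filter.1 hl).2
    exact ⟨t, fun _ => ⟨ht.trans (Finset.filter_subset _ _), h3,
      fun p hp => (Finset.mem_filter.1 (ht hp)).2.symm⟩⟩
  choose T hT using h
  obtain ⟨A, hA, B, hB, h1, h2, h3⟩ := exists_min_degree D T Q (richLines L Q)
    fun l hl => (hT l hl).1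
  refine ⟨A, hA, B, hB.trans (richLines_subset _ _), RigidLE.of_triples T h1
    (fun l hl => (hT l (hB hl)).2.1) (fun l hl => (hT l (hB hl)).2.2) D hD
    (fun p hp => by convert h2 p hp) R
    (lt_of_le_of_lt (by exact_mod_cast Finset.card_le_card hB) hR), by linarith⟩

theorem richLines_subset_linesMeeting (L Q : Finset (ℝ × ℝ)) :
    richLines L Q ⊆ linesMeeting L Q := by
  classical
  intro l hl
  obtain ⟨hl, h3⟩ := Finset.mem_filter.1 hl
  have h0 : 0 < (Q.filter fun p => Inc l p).card := by unfold incDeg at h3; omega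
  obtain ⟨p, hp⟩ := Finset.card_pos.1 h0
  obtain ⟨hp, hi⟩ := Finset.mem_filter.1 hp
  exact Finset.mem_filter.2 ⟨hl, p, hp, hi.symm⟩

theorem incCount_le_richLines (Q L : Finset (ℝ × ℝ)) :
    incCount Q L ≤ 2 * (linesMeeting L Q).card + incCount Q (richLines L Q) := by
  classical
  rw [← incCount_linesMeeting, incCount_comm,
    ← incCount_sdiff (richLines_subset_linesMeeting L Q), incCount_comm Q]
  refine Nat.add_le_add_right ?_ _
  have : incCount (linesMeeting L Q \ richLines L Q) Q ≤
      ∑ l ∈ linesMeeting L Q \ richLines L Q, 2 := by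
    refine Finset.sum_le_sum fun l hl => ?_
    obtain ⟨h1, h2⟩ := Finset.mem_sdiff.1 hl
    by_contra! h3
    exact h2 (Finset.mem_filter.2 ⟨linesMeeting_subset _ _ h1, h3⟩)
  refine this.trans ?_
  rw [Finset.sum_const, smul_eq_mul, mul_comm]
  exact Nat.mul_le_mul_left 2 (Finset.card_le_card Finset.sdiff_subset)

/-- Discarding poor points and lines leaves a configuration without poor points and lines. -/
theorem exists_prune (a b : ℝ) (P L : Finset (ℝ × ℝ)) :
    ∃ P' ⊆ P, ∃ L' ⊆ L, (∀ p ∈ P', a ≤ incDeg L' p) ∧ (∀ l ∈ L', b ≤ incDeg P' l) ∧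
      (incCount P L : ℝ) + a * P'.card + b * L'.card ≤
        incCount P' L' + a * P.card + b * L.card := by
  classical
  induction h : P.card + L.card using Nat.strong_induction_on generalizing P L with
  | _ N ih =>
    by_cases hP : ∀ p ∈ P, a ≤ incDeg L p
    swap
    · push Not at hP
      obtain ⟨p, hp, hpa⟩ := hP
      have h5 := Finset.card_erase_add_one hp
      obtain ⟨P', hP', L', hL', h1, h2, h3⟩ := ih _ (by omega) (P.erase p) L rfl
      refine ⟨P', hP'.trans (Finset.erase_subset _ _), L', hL', h1, h2, ?_⟩
      have h4 : incDeg L p + incCount (P.erase p) L = incCount P L := Finset.add_sum_erase _ _ hp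
      rw [← h5, ← h4]
      push_cast
      linarith
    by_cases hL : ∀ l ∈ L, b ≤ incDeg P l
    swap
    · push Not at hL
      obtain ⟨l, hl, hlb⟩ := hL
      have h5 := Finset.card_erase_add_one hl
      obtain ⟨P', hP', L', hL', h1, h2, h3⟩ := ih _ (by omega) P (L.erase l) rfl
      refine ⟨P', hP', L', hL'.trans (Finset.erase_subset _ _), h1, h2, ?_⟩
      have h4 : incDeg P l + incCount (L.erase l) P = incCount L P := Finset.add_sum_erase _ _ hl
      rw [incCount_comm P L, ← h5, ← h4, incCount_comm _ P]
      push_cast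
      linarith
    exact ⟨P, subset_rfl, L, subset_rfl, hP, hL, le_rfl⟩

theorem incCount_le_of_not_rich {Q L : Finset (ℝ × ℝ)} {η ρ t : ℝ} (hη : 0 < η) (hη1 : η ≤ 1)
    (hρη : 26 ≤ η * ρ) (hρ0 : 0 < ρ) (ht0 : 0 < t) (hηt : 1 ≤ η * t)
    (hM : ((linesMeeting L Q).card : ℝ) ≤ 25 * ρ * t ^ 2)
    (hno' : (Q.card : ℝ) ≤ 625 / η ^ 3 * ρ ^ 2 * t →
      ((richLines L Q).card : ℝ) ≤ η ^ 5 / 625 * ρ * t ^ 2) :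
    (incCount Q L : ℝ) ≤ 240 * η * (ρ ^ 2 * t ^ 2) + 240 * η * t * Q.card := by
  have hN0 : (0 : ℝ) ≤ Q.card := Nat.cast_nonneg _
  have hE0 : (0 : ℝ) ≤ (richLines L Q).card := Nat.cast_nonneg _
  have hE : ((richLines L Q).card : ℝ) ≤ 25 * ρ * t ^ 2 :=
    le_trans (by exact_mod_cast Finset.card_le_card (richLines_subset_linesMeeting L Q)) hM
  have hx : (Q.card : ℝ) ^ 2 * ((richLines L Q).card : ℝ) ^ 2 ≤
      (η * (ρ ^ 2 * t ^ 2 + t * Q.card)) ^ 3 := by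
    generalize (Q.card : ℝ) = N at hN0 hno' ⊢
    generalize ((richLines L Q).card : ℝ) = E at hE0 hE hno' ⊢
    rcases le_or_gt N (625 / η ^ 3 * ρ ^ 2 * t) with hN | hN
    · have hE' := hno' hN
      calc N ^ 2 * E ^ 2
          ≤ (625 / η ^ 3 * ρ ^ 2 * t) ^ 2 * (η ^ 5 / 625 * ρ * t ^ 2) ^ 2 := by gcongr
        _ = η * (η * (ρ ^ 2 * t ^ 2)) ^ 3 := by field_simp
        _ ≤ 1 * (η * (ρ ^ 2 * t ^ 2)) ^ 3 := by gcongr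
        _ ≤ (η * (ρ ^ 2 * t ^ 2 + t * N)) ^ 3 := by
          rw [one_mul]
          gcongr
          exact le_add_of_nonneg_right (by positivity)
    · have hN' : 625 * ρ ^ 2 * t ≤ η ^ 3 * N := by
        have : η ^ 3 * (625 / η ^ 3 * ρ ^ 2 * t) ≤ η ^ 3 * N := by gcongr
        refine le_trans (le_of_eq ?_) this
        field_simp
      calc N ^ 2 * E ^ 2 ≤ N ^ 2 * (25 * ρ * t ^ 2) ^ 2 := by gcongr
        _ = N ^ 2 * t ^ 3 * (625 * ρ ^ 2 * t) := by ring
        _ ≤ N ^ 2 * t ^ 3 * (η ^ 3 * N) := by gcongr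
        _ = (η * (t * N)) ^ 3 := by ring
        _ ≤ (η * (ρ ^ 2 * t ^ 2 + t * N)) ^ 3 := by
          gcongr
          exact le_add_of_nonneg_left (by positivity)
  have h1 := incCount_le_szemerediTrotter Q (richLines L Q) (by positivity) hx
  have h2 : (incCount Q L : ℝ) ≤ 2 * (linesMeeting L Q).card + incCount Q (richLines L Q) := by
    exact_mod_cast incCount_le_richLines Q L
  have h4 : (Q.card : ℝ) ≤ η * t * Q.card := le_mul_of_one_le_left hN0 hηt
  have h5 : 26 * (ρ * t ^ 2) ≤ η * (ρ ^ 2 * t ^ 2) := by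
    calc 26 * (ρ * t ^ 2) ≤ η * ρ * (ρ * t ^ 2) := by gcongr
      _ = _ := by ring
  nlinarith

/-- A configuration with many incidences contains a cell with few points and many rich lines. -/
theorem exists_rich_cell {P L L' : Finset (ℝ × ℝ)} {η σ s t : ℝ} (hη : 0 < η) (hη1 : η ≤ 1)
    (hσ : 32 ≤ σ) (hση : 26 ≤ η * σ) (hst : s ≤ t) (hs : σ ≤ s)
    (hP : P.card ≤ s ^ 2 * t) (hL : L.card ≤ t ^ 2 * s) (hL' : L' ⊆ L) (hsL : s ^ 2 ≤ L.card)
    (hdeg : ∀ p ∈ P, incDeg L p ≤ 2 * √L.card)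
    (hI : 12000 * η * (s * t) ^ 2 ≤ incCount P L') :
    ∃ ρ, σ ≤ ρ ∧ ρ ≤ 2 * σ ∧ ∃ Q ⊆ P, (Q.card : ℝ) ≤ 625 / η ^ 3 * ρ ^ 2 * t ∧
      η ^ 5 / 625 * ρ * t ^ 2 ≤ (richLines L' Q).card ∧
      ((richLines L' Q).card : ℝ) ≤ 25 * ρ * t ^ 2 := by
  have hσ0 : 0 < σ := by linarith
  have hs0 : 0 < s := by linarith
  have ht0 : 0 < t := by linarith
  have hs1 : 1 ≤ s := by linarith
  set r := ⌊s / σ⌋₊ with hr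
  have hr1 : 1 ≤ r := Nat.le_floor (by push_cast; rwa [le_div_iff₀ hσ0, one_mul])
  have hr1' : (1 : ℝ) ≤ r := by exact_mod_cast hr1
  have hr0 : (0 : ℝ) < r := by linarith
  have hrs : r * σ ≤ s := by
    rw [← le_div_iff₀ hσ0]; exact Nat.floor_le (by positivity)
  have hsr : s ≤ r * (2 * σ) := by
    have h1 : s / σ < r + 1 := Nat.lt_floor_add_one _
    rw [div_lt_iff₀ hσ0] at h1
    nlinarith
  obtain ⟨ρ, hρ⟩ : ∃ ρ, s = r * ρ := ⟨s / r, by field_simp⟩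
  have hρσ : σ ≤ ρ := by rw [hρ] at hrs; exact le_of_mul_le_mul_left hrs hr0
  have hσρ : ρ ≤ 2 * σ := by rw [hρ] at hsr; exact le_of_mul_le_mul_left hsr hr0
  have hρ0 : 0 < ρ := hσ0.trans_le hρσ
  have hsL' : s ≤ √L.card := Real.le_sqrt_of_sq_le hsL
  have hLL : √(L.card : ℝ) * √L.card = L.card := Real.mul_self_sqrt (Nat.cast_nonneg _)
  obtain ⟨G, hG, hw, ι, κ, K, hκ, hK, hM⟩ := exists_cells P L (fun p => (incDeg L' p : ℝ))
    (fun _ _ => by positivity) r hr1 (by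
      have : (r : ℝ) ≤ L.card := by nlinarith
      exact_mod_cast this) (fun p hp => by
      have h1 : (8 * r * incDeg L p : ℝ) ≤ L.card := by
        rw [← hLL]
        have h2 := hdeg p hp
        generalize √(L.card : ℝ) = q at h2 hsL' ⊢
        have hq : 0 ≤ q := hs0.le.trans hsL'
        calc (8 * r * incDeg L p : ℝ) ≤ 8 * r * (2 * q) := by gcongr
          _ = (r * 16) * q := by ring
          _ ≤ q * q := by gcongr; nlinarith
      exact_mod_cast h1)
  by_contra! hno
  refine absurd hI (not_le.2 ?_)
  have hM' : ∀ k, ((linesMeeting L' (cellPoints G κ k)).card : ℝ) ≤ 25 * ρ * t ^ 2 := by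
    intro k
    have h1 : ((linesMeeting L' (cellPoints G κ k)).card : ℝ) ≤
        (linesMeeting L (cellPoints G κ k)).card := by
      classical
      exact_mod_cast Finset.card_le_card (Finset.filter_subset_filter _ hL')
    have h2 : (r : ℝ) * (linesMeeting L (cellPoints G κ k)).card ≤ 25 * L.card := by
      exact_mod_cast hM k
    refine le_of_mul_le_mul_left ?_ hr0
    calc (r : ℝ) * (linesMeeting L' (cellPoints G κ k)).card
        ≤ r * (linesMeeting L (cellPoints G κ k)).card := by gcongr
      _ ≤ 25 * (t ^ 2 * s) := by linarith
      _ = r * (25 * ρ * t ^ 2) := by rw [hρ]; ring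
  have hηt : 1 ≤ η * t := by nlinarith
  have hcell : ∀ k, ((∑ p ∈ cellPoints G κ k, incDeg L' p : ℕ) : ℝ) ≤
      240 * η * (ρ ^ 2 * t ^ 2) + 240 * η * t * (cellPoints G κ k).card := by
    intro k
    refine incCount_le_of_not_rich hη hη1 (hση.trans (by gcongr)) hρ0 ht0 hηt (hM' k) fun hN => ?_
    by_contra! h
    refine (hno ρ hρσ hσρ _ ((cellPoints_subset _ _ _).trans hG) hN h.le).not_ge (le_trans ?_ (hM' k))
    exact_mod_cast Finset.card_le_card (richLines_subset_linesMeeting L' _)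
  clear hno
  have hsum : (incCount G L' : ℝ) ≤ 5000 * η * (s * t) ^ 2 := by
    rw [incCount, ← sum_cellPoints hκ, Nat.cast_sum]
    refine (Finset.sum_le_sum fun k _ => hcell k).trans ?_
    rw [Finset.sum_add_distrib, Finset.sum_const, nsmul_eq_mul, ← Finset.mul_sum, ← Nat.cast_sum,
      sum_card_cellPoints hκ]
    have h4 : (K.card : ℝ) ≤ 18 * r ^ 2 := by exact_mod_cast hK
    have h5 : (G.card : ℝ) ≤ s ^ 2 * t := le_trans (by exact_mod_cast Finset.card_le_card hG) hP
    have h6 : (K.card : ℝ) * (240 * η * (ρ ^ 2 * t ^ 2)) ≤ 4320 * η * (s * t) ^ 2 := by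
      calc (K.card : ℝ) * (240 * η * (ρ ^ 2 * t ^ 2)) ≤ 18 * r ^ 2 * (240 * η * (ρ ^ 2 * t ^ 2)) := by
            gcongr
        _ = 4320 * η * (s * t) ^ 2 := by rw [hρ]; ring
    have h7 : 240 * η * t * G.card ≤ 240 * η * (s * t) ^ 2 := by
      calc 240 * η * t * G.card ≤ 240 * η * t * (s ^ 2 * t) := by gcongr
        _ = _ := by ring
    have : 0 ≤ η * (s * t) ^ 2 := by positivity
    linarith
  have hw' : (incCount P L' : ℝ) ≤ 2 * incCount G L' := by simpa [incCount] using hw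
  have : 0 < η * (s * t) ^ 2 := by positivity
  linarith

theorem sq_le_card_lines {P L : Finset (ℝ × ℝ)} {Δ s t : ℝ} (hΔ : 0 < Δ) (hs : 1 ≤ s)
    (hst : s ≤ t) (hsΔ : 4 ≤ Δ * s) (hsΔ2 : 16 ≤ Δ ^ 2 * s) (hP : P.card ≤ s ^ 2 * t)
    (hI : Δ * (s * t) ^ 2 ≤ incCount P L) : s ^ 2 ≤ L.card := by
  have h1 := hI.trans (incCount_le P L)
  have hsq : √(P.card : ℝ) ^ 2 = P.card := Real.sq_sqrt (Nat.cast_nonneg _)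
  have hL0 : (0 : ℝ) ≤ L.card := Nat.cast_nonneg _
  have hq0 : 0 ≤ √(P.card : ℝ) := Real.sqrt_nonneg _
  generalize (L.card : ℝ) = ℓ at *
  generalize √(P.card : ℝ) = q at *
  rw [← hsq] at hP h1
  have ht : 0 < t := by linarith
  have h2 : 4 * (s ^ 2 * t) ≤ Δ * (s * t) ^ 2 := by
    calc 4 * (s ^ 2 * t) ≤ Δ * s * (s ^ 2 * t) := by gcongr
      _ ≤ Δ * t * (s ^ 2 * t) := by gcongr
      _ = _ := by ring
  have h3 : Δ * (s * t) ^ 2 ≤ 4 * (q * ℓ) := by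
    have : 0 ≤ q * ℓ := by positivity
    linarith
  have h4 : (Δ * (s * t) ^ 2) ^ 2 ≤ 16 * (s ^ 2 * t) * ℓ ^ 2 := by
    calc (Δ * (s * t) ^ 2) ^ 2 ≤ (4 * (q * ℓ)) ^ 2 := by gcongr
      _ = 16 * q ^ 2 * ℓ ^ 2 := by ring
      _ ≤ _ := by gcongr
  have h5 : 16 * (s ^ 2 * t) * (s ^ 2) ^ 2 ≤ 16 * (s ^ 2 * t) * ℓ ^ 2 := by
    refine le_trans ?_ h4
    calc 16 * (s ^ 2 * t) * (s ^ 2) ^ 2 ≤ Δ ^ 2 * s * (s ^ 2 * t) * (s ^ 2) ^ 2 := by gcongr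
      _ = Δ ^ 2 * s ^ 4 * t * s * s ^ 2 := by ring
      _ ≤ Δ ^ 2 * s ^ 4 * t * t * t ^ 2 := by gcongr
      _ = _ := by ring
  exact le_of_pow_le_pow_left₀ two_ne_zero hL0 (le_of_mul_le_mul_left h5 (by positivity))

/-- Removing very rich points, and then poor points and lines. -/
theorem exists_regular_subconfig {P L : Finset (ℝ × ℝ)} {Δ s t : ℝ} (hΔ : 0 < Δ) (hs : 1 ≤ s)
    (ht : 1 ≤ t) (hsΔ : 8 ≤ Δ * s) (hP : P.card ≤ s ^ 2 * t) (hL : L.card ≤ t ^ 2 * s)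
    (hI : Δ * (s * t) ^ 2 ≤ incCount P L) :
    ∃ P' ⊆ P, ∃ L' ⊆ L, (∀ p ∈ P', Δ / 8 * t ≤ incDeg L' p) ∧ (∀ l ∈ L', Δ / 8 * s ≤ incDeg P' l) ∧
      (∀ p ∈ P', incDeg L p ≤ 2 * √L.card) ∧ Δ / 2 * (s * t) ^ 2 ≤ incCount P' L' := by
  classical
  have hs0 : 0 < s := by linarith
  have ht0 : 0 < t := by linarith
  set Q := P.filter fun p => 2 * √(L.card : ℝ) < incDeg L p with hQ
  have hrich : incCount Q L ≤ 2 * L.card := by convert incCount_rich_le P L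
  have hrich' : (incCount Q L : ℝ) ≤ 2 * L.card := by exact_mod_cast hrich
  have hsplit : (incCount (P \ Q) L : ℝ) + incCount Q L = incCount P L := by
    exact_mod_cast incCount_sdiff (Finset.filter_subset _ P) L
  obtain ⟨P', hP', L', hL', h1, h2, h3⟩ := exists_prune (Δ / 8 * t) (Δ / 8 * s) (P \ Q) L
  refine ⟨P', hP'.trans Finset.sdiff_subset, L', hL', h1, h2, fun p hp => ?_, ?_⟩
  · by_contra! h
    obtain ⟨hpP, hpQ⟩ := Finset.mem_sdiff.1 (hP' hp)
    exact hpQ (Finset.mem_filter.2 ⟨hpP, h⟩)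
  have h4 : 2 * (t ^ 2 * s) ≤ Δ / 4 * (s * t) ^ 2 := by
    calc 2 * (t ^ 2 * s) = 8 * (t ^ 2 * s) / 4 := by ring
      _ ≤ Δ * s * (t ^ 2 * s) / 4 := by gcongr
      _ = _ := by ring
  have h5 : ((P \ Q).card : ℝ) ≤ s ^ 2 * t :=
    le_trans (by exact_mod_cast Finset.card_le_card Finset.sdiff_subset) hP
  have h6 : Δ / 8 * t * (P \ Q).card ≤ Δ / 8 * (s * t) ^ 2 := by
    calc Δ / 8 * t * (P \ Q).card ≤ Δ / 8 * t * (s ^ 2 * t) := by gcongr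
      _ = _ := by ring
  have h7 : Δ / 8 * s * L.card ≤ Δ / 8 * (s * t) ^ 2 := by
    calc Δ / 8 * s * L.card ≤ Δ / 8 * s * (t ^ 2 * s) := by gcongr
      _ = _ := by ring
  have h8 : 0 ≤ Δ / 8 * t * P'.card := by positivity
  have h9 : 0 ≤ Δ / 8 * s * L'.card := by positivity
  linarith

theorem exists_rigidLE_of_rich_cell {Q L : Finset (ℝ × ℝ)} {R : ℕ} {η θ ρ σ t : ℝ} (hη : 0 < η)
    (hσ : 0 < σ) (hρ0 : 0 < ρ) (hρ : ρ ≤ 2 * σ) (hθ : θ = η ^ 8 / (4 * 625 ^ 2 * σ)) (ht : 0 < t)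
    (hθt : 2 ≤ θ * t)
    (hR : 80000 * σ / θ ^ 2 ≤ R) (hQ : (Q.card : ℝ) ≤ 625 / η ^ 3 * ρ ^ 2 * t)
    (hE : η ^ 5 / 625 * ρ * t ^ 2 ≤ (richLines L Q).card)
    (hE' : ((richLines L Q).card : ℝ) ≤ 25 * ρ * t ^ 2) :
    ∃ A ⊆ Q, ∃ B ⊆ L, RigidLE A B R ∧ (richLines L Q).card ≤ 2 * B.card := by
  have hθ0 : 0 < θ := by rw [hθ]; positivity
  have hD2 : 2 ≤ ⌊θ * t⌋₊ := Nat.le_floor (by exact_mod_cast hθt)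
  have hDle : (⌊θ * t⌋₊ : ℝ) ≤ θ * t := Nat.floor_le (by positivity)
  have hDge : θ * t / 2 ≤ ⌊θ * t⌋₊ := by
    have h1 : θ * t < ⌊θ * t⌋₊ + 1 := Nat.lt_floor_add_one _
    linarith
  refine exists_rigidLE_of_rich hD2 ?_ ?_
  · have : (2 * ⌊θ * t⌋₊ * Q.card : ℝ) ≤ (richLines L Q).card := by
      refine le_trans ?_ hE
      calc (2 * ⌊θ * t⌋₊ * Q.card : ℝ) ≤ 2 * (θ * t) * (625 / η ^ 3 * ρ ^ 2 * t) := by gcongr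
        _ = η ^ 5 / 625 * t ^ 2 * ρ * (ρ / (2 * σ)) := by rw [hθ]; field_simp; ring
        _ ≤ η ^ 5 / 625 * t ^ 2 * ρ * 1 := by
          gcongr
          exact (div_le_one (by positivity)).2 hρ
        _ = _ := by ring
    exact_mod_cast this
  · have h1 : (θ * t / 2 / 20) ^ 2 ≤ ((⌊θ * t⌋₊ : ℝ) / 20) ^ 2 := by gcongr
    have h2 : 0 < (θ * t / 2 / 20) ^ 2 := by positivity
    rw [div_le_iff₀ (by positivity)] at hR
    calc ((richLines L Q).card : ℝ) ≤ 25 * ρ * t ^ 2 := hE'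
      _ ≤ 25 * (2 * σ) * t ^ 2 := by gcongr
      _ = 80000 * σ * (t ^ 2 / 1600) := by ring
      _ ≤ R * θ ^ 2 * (t ^ 2 / 1600) := by gcongr
      _ = R * (θ * t / 2 / 20) ^ 2 := by ring
      _ < (R + 1) * (θ * t / 2 / 20) ^ 2 := by linarith
      _ ≤ (R + 1) * ((⌊θ * t⌋₊ : ℝ) / 20) ^ 2 := by gcongr

theorem exists_rigid_subconfig_of_le {Δ : ℝ} (hΔ : 0 < Δ) (hΔ1 : Δ ≤ 1) :
    ∃ (S c : ℝ) (R : ℕ), 1 ≤ S ∧ 0 < c ∧ ∀ (P L : Finset (ℝ × ℝ)) (s t : ℝ), S ≤ s → s ≤ t →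
      P.card ≤ s ^ 2 * t → L.card ≤ t ^ 2 * s → Δ * (s * t) ^ 2 ≤ incCount P L →
      ∃ A ⊆ P, ∃ B ⊆ L, RigidLE A B R ∧ c * (s ^ 2 * t) ≤ A.card ∧ c * (t ^ 2 * s) ≤ B.card := by
  obtain ⟨α, hα⟩ : ∃ α, α = Δ / 8 := ⟨_, rfl⟩
  obtain ⟨η, hη⟩ : ∃ η, η = Δ / 24000 := ⟨_, rfl⟩
  have hα0 : 0 < α := by linarith
  have hη0 : 0 < η := by linarith
  obtain ⟨σ, hσ⟩ : ∃ σ, σ = 32 + 26 / η + 2500 / (α * η ^ 5) := ⟨_, rfl⟩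
  have hσ0 : 0 < σ := by rw [hσ]; positivity
  obtain ⟨θ, hθ⟩ : ∃ θ, θ = η ^ 8 / (4 * 625 ^ 2 * σ) := ⟨_, rfl⟩
  have hθ0 : 0 < θ := by rw [hθ]; positivity
  have hσ32 : 32 ≤ σ := by
    rw [hσ, add_assoc]; exact le_add_of_nonneg_right (by positivity)
  have hση : 26 ≤ η * σ := by
    have : 26 / η ≤ σ := by
      have h1 : 0 < 2500 / (α * η ^ 5) := by positivity
      linarith
    rwa [div_le_iff₀ hη0, mul_comm] at this
  have hσα : 2500 ≤ α * η ^ 5 * σ := by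
    have : 2500 / (α * η ^ 5) ≤ σ := by
      have h1 : 0 < 26 / η := by positivity
      linarith
    rwa [div_le_iff₀ (by positivity), mul_comm] at this
  refine ⟨σ + 8 / Δ + 16 / Δ ^ 2 + 2 / θ + 2 / (α * (α / 720) ^ 3), (α / 720) ^ 5,
    ⌈80000 * σ / θ ^ 2⌉₊, ?_, by positivity, ?_⟩
  · have h1 : 0 < 8 / Δ := by positivity
    have h2 : 0 < 16 / Δ ^ 2 := by positivity
    have h3 : 0 < 2 / θ := by positivity
    have h4 : 0 < 2 / (α * (α / 720) ^ 3) := by positivity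
    linarith
  intro P L s t hs hst hP hL hI
  obtain ⟨hsσ, hs1, hs2, hs3, hs4⟩ : σ ≤ s ∧ 8 / Δ ≤ s ∧ 16 / Δ ^ 2 ≤ s ∧ 2 / θ ≤ s ∧
      2 / (α * (α / 720) ^ 3) ≤ s := by
    have h1 : 0 < 8 / Δ := by positivity
    have h2 : 0 < 16 / Δ ^ 2 := by positivity
    have h3 : 0 < 2 / θ := by positivity
    have h4 : 0 < 2 / (α * (α / 720) ^ 3) := by positivity
    refine ⟨?_, ?_, ?_, ?_, ?_⟩ <;> linarith
  rw [div_le_iff₀ (by positivity), mul_comm] at hs1 hs2 hs3 hs4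
  have hs0 : 1 ≤ s := by linarith
  have ht0 : 0 < t := by linarith
  obtain ⟨P₁, hP₁, L₁, hL₁, hPdeg, hLdeg, hdeg, hI₁⟩ :=
    exists_regular_subconfig hΔ hs0 (hs0.trans hst) hs1 hP hL hI
  rw [← hα] at hPdeg hLdeg
  have hP₁c : (P₁.card : ℝ) ≤ s ^ 2 * t :=
    le_trans (by exact_mod_cast Finset.card_le_card hP₁) hP
  have hL₁c : (L₁.card : ℝ) ≤ t ^ 2 * s :=
    le_trans (by exact_mod_cast Finset.card_le_card hL₁) hL
  obtain ⟨ρ, hσρ, hρσ, Q, hQ, hQc, hE, hE'⟩ := exists_rich_cell hη0 (by linarith) hσ32 hση hst hsσ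
    hP₁c hL hL₁ (sq_le_card_lines hΔ hs0 hst (by linarith) hs2 hP hI) hdeg
    (le_trans (le_of_eq (by rw [hη]; ring)) hI₁)
  obtain ⟨A₀, hA₀, B₀, hB₀, hR, hB₀c⟩ := exists_rigidLE_of_rich_cell (R := ⌈80000 * σ / θ ^ 2⌉₊)
    hη0 hσ0 (hσ0.trans_le hσρ) hρσ hθ ht0 (hs3.trans (by gcongr)) (Nat.le_ceil _) hQc hE hE'
  obtain ⟨A, B, -, hA, hBB, hB, hAB, hclA, hclB⟩ := hR.exists_closure (hA₀.trans hQ) hB₀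
  have hBc : 2 * t ^ 2 ≤ α * B.card := by
    have h1 : (B₀.card : ℝ) ≤ B.card := by exact_mod_cast Finset.card_le_card hBB
    have h2 : ((richLines L₁ Q).card : ℝ) ≤ 2 * B₀.card := by exact_mod_cast hB₀c
    have h3 : η ^ 5 / 625 * σ * t ^ 2 ≤ 2 * B.card := by
      have : η ^ 5 / 625 * σ * t ^ 2 ≤ η ^ 5 / 625 * ρ * t ^ 2 := by gcongr
      linarith
    calc 2 * t ^ 2 = 2500 * (t ^ 2 / 1250) := by ring
      _ ≤ α * η ^ 5 * σ * (t ^ 2 / 1250) := by gcongr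
      _ = α / 2 * (η ^ 5 / 625 * σ * t ^ 2) := by ring
      _ ≤ α / 2 * (2 * B.card) := by gcongr
      _ = α * B.card := by ring
  exact ⟨A, hA.trans hP₁, B, hB.trans hL₁, hAB, card_closure_ge hα0 (by linarith) hst hs4 hP₁c hL₁c
    hA hB hPdeg hLdeg hclA hclB hBc⟩

/-- A configuration with `s²t` points, `t²s` lines and at least `Δ(st)²` incidences contains a
rigid subconfiguration with a positive proportion of the points and lines. -/
theorem exists_rigid_subconfig {Δ : ℝ} (hΔ : 0 < Δ) (hΔ1 : Δ ≤ 1) :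
    ∃ (S c : ℝ) (R : ℕ), 1 ≤ S ∧ 0 < c ∧ ∀ (P L : Finset (ℝ × ℝ)) (s t : ℝ), S ≤ s → S ≤ t →
      P.card ≤ s ^ 2 * t → L.card ≤ t ^ 2 * s → Δ * (s * t) ^ 2 ≤ incCount P L →
      ∃ A ⊆ P, ∃ B ⊆ L, RigidLE A B R ∧ c * (s ^ 2 * t) ≤ A.card := by
  obtain ⟨S, c, R, hS, hc, h⟩ := exists_rigid_subconfig_of_le hΔ hΔ1
  refine ⟨S, c, R, hS, hc, fun P L s t hs ht hP hL hI => ?_⟩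
  rcases le_total s t with hst | hst
  · obtain ⟨A, hA, B, hB, hAB, hAc, -⟩ := h P L s t hs hst hP hL hI
    exact ⟨A, hA, B, hB, hAB, hAc⟩
  · obtain ⟨B, hB, A, hA, hAB, -, hAc⟩ := h L P t s ht hst hL hP
      (by rw [mul_comm t, incCount_comm]; exact hI)
    exact ⟨A, hA, B, hB, hAB.symm, hAc⟩

theorem ConfigRigid.mono {P : Set (ℝ × ℝ)} {L : Set (Set (ℝ × ℝ))} {r r' : ℕ}
    (h : ConfigRigid P L r) (hr : r ≤ r') : ConfigRigid P L r' :=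
  ⟨h.1, fun V hV hP k c hc hcV hcm => (h.2 V hV hP k c hc hcV hcm).trans hr⟩

/-- The non-vertical line with coordinates `q`. -/
def lineSet (q : ℝ × ℝ) : Set (ℝ × ℝ) := {p | Inc p q}

theorem lineSet_injective : Function.Injective lineSet := by
  intro q r h
  have h1 : ((0, -q.2) : ℝ × ℝ) ∈ lineSet q := by simp [lineSet, Inc]
  have h2 : ((1, q.1 - q.2) : ℝ × ℝ) ∈ lineSet q := by simp [lineSet, Inc]
  have h3 : ((0, -q.2) : ℝ × ℝ) ∈ lineSet r := h ▸ h1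
  have h4 : ((1, q.1 - q.2) : ℝ × ℝ) ∈ lineSet r := h ▸ h2
  exact Inc.eq_of_ne h1 h2 h3 h4 (by simp)

theorem IsLine.eq_lineSet_or_vertical {l : Set (ℝ × ℝ)} (hl : IsLine l) :
    (∃ q, l = lineSet q) ∨ ∃ x, l = {z | z.1 = x} := by
  obtain ⟨a, b, c, hab, rfl⟩ := hl
  rcases eq_or_ne b 0 with rfl | hb
  · have ha : a ≠ 0 := fun h => hab (by rw [h])
    refine .inr ⟨c / a, ?_⟩
    ext z
    simp only [Set.mem_ofPred_eq, zero_mul, add_zero]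
    rw [eq_div_iff ha, mul_comm]
  · refine .inl ⟨(-a / b, -c / b), ?_⟩
    ext z
    simp only [lineSet, Inc, Set.mem_ofPred_eq]
    field_simp
    constructor <;> intro h <;> linarith

theorem card_incidences_le (P L : Finset (ℝ × ℝ)) (𝓛 : Set (Set (ℝ × ℝ)))
    (h𝓛 : ∀ l ∈ 𝓛, IsLine l) (hL : ∀ q, lineSet q ∈ 𝓛 → q ∈ L) :
    (Incidences (P : Set (ℝ × ℝ)) 𝓛).ncard ≤ incCount P L + P.card := by
  classical
  set X := ((P ×ˢ L).filter fun x => Inc x.1 x.2).image fun x => (x.1, lineSet x.2) with hX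
  set Y := P.image fun p => (p, {z : ℝ × ℝ | z.1 = p.1}) with hY
  have hsub : Incidences (P : Set (ℝ × ℝ)) 𝓛 ⊆ ((X ∪ Y : Finset _) : Set _) := by
    rintro ⟨p, l⟩ ⟨hp, hl, hpl⟩
    simp only at hp hl hpl
    rw [Finset.coe_union]
    rcases (h𝓛 l hl).eq_lineSet_or_vertical with ⟨q, rfl⟩ | ⟨x, rfl⟩
    · exact .inl (Finset.mem_coe.2 (Finset.mem_image.2
        ⟨(p, q), Finset.mem_filter.2 ⟨Finset.mem_product.2 ⟨hp, hL q hl⟩, hpl⟩, rfl⟩))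
    · refine .inr (Finset.mem_coe.2 (Finset.mem_image.2 ⟨p, hp, ?_⟩))
      rw [show p.1 = x from hpl]
  have h1 := Set.ncard_le_ncard hsub (Finset.finite_toSet _)
  rw [Set.ncard_coe_finset] at h1
  refine h1.trans ((Finset.card_union_le _ _).trans (Nat.add_le_add ?_ Finset.card_image_le))
  refine Finset.card_image_le.trans (le_of_eq ?_)
  rw [Finset.card_filter, Finset.sum_product]
  refine Finset.sum_congr rfl fun p _ => ?_
  rw [incDeg, Finset.card_filter]

theorem exists_sizes {n m : ℝ} (hn : 0 < n) (hm : 0 < m) :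
    ∃ s t : ℝ, 0 ≤ s ∧ 0 ≤ t ∧ s ^ 3 = n ^ 2 / m ∧ t ^ 3 = m ^ 2 / n ∧ s ^ 2 * t = n ∧
      t ^ 2 * s = m ∧ n ^ ((2 : ℝ) / 3) * m ^ ((2 : ℝ) / 3) = (s * t) ^ 2 := by
  obtain ⟨s, hs, hs3⟩ := exists_cube_eq (y := n ^ 2 / m) (by positivity)
  obtain ⟨t, ht, ht3⟩ := exists_cube_eq (y := m ^ 2 / n) (by positivity)
  have hcube : ∀ {x y : ℝ}, 0 ≤ x → 0 ≤ y → x ^ 3 = y ^ 3 → x = y := fun hx hy h =>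
    (pow_left_inj₀ hx hy three_ne_zero).1 h
  have hst : s ^ 2 * t = n := hcube (by positivity) hn.le (by
    rw [show (s ^ 2 * t) ^ 3 = (s ^ 3) ^ 2 * t ^ 3 by ring, hs3, ht3]; field_simp)
  have hts : t ^ 2 * s = m := hcube (by positivity) hm.le (by
    rw [show (t ^ 2 * s) ^ 3 = (t ^ 3) ^ 2 * s ^ 3 by ring, hs3, ht3]; field_simp)
  refine ⟨s, t, hs, ht, hs3, ht3, hst, hts, ?_⟩
  rw [← Real.mul_rpow hn.le hm.le, ← hst, ← hts,
    show s ^ 2 * t * (t ^ 2 * s) = (s * t) ^ 3 by ring, ← Real.rpow_natCast (s * t) 3,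
    ← Real.rpow_natCast (s * t) 2, ← Real.rpow_mul (by positivity)]
  norm_num

/-- Main theorem: extremal Szemerédi–Trotter configurations are rigid.  For every
`Δ > 0` there are constants `C₁ ≥ 1`, `c > 0` and a positive integer `r`,
depending only on `Δ`, such that whenever `n` points and `m` lines with
`m ≤ n²/C₁`, `n ≤ m²/C₁` determine at least `Δ n^{2/3} m^{2/3}` incidences,
some subset `P' ⊆ P` with `|P'| ≥ c n` yields an `r`-rigid configuration
`(P', L)`. -/
theorem rigidity_of_extremal_ST_configurations (Δ : ℝ) (hΔ : 0 < Δ) :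
    ∃ (C₁ c : ℝ) (r : ℕ), 1 ≤ C₁ ∧ 0 < c ∧ 0 < r ∧
      ∀ (n m : ℕ) (P : Set (ℝ × ℝ)) (L : Set (Set (ℝ × ℝ))),
        P.Finite → L.Finite → (∀ l ∈ L, IsLine l) →
        P.ncard = n → L.ncard = m →
        (m : ℝ) ≤ (n : ℝ) ^ 2 / C₁ → (n : ℝ) ≤ (m : ℝ) ^ 2 / C₁ →
        Δ * (n : ℝ) ^ ((2 : ℝ) / 3) * (m : ℝ) ^ ((2 : ℝ) / 3) ≤
          ((Incidences P L).ncard : ℝ) →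
        ∃ P' ⊆ P, c * (n : ℝ) ≤ (P'.ncard : ℝ) ∧ ConfigRigid P' L r := by
  obtain ⟨Δ', hΔ'⟩ : ∃ Δ', Δ' = min Δ 1 / 2 := ⟨_, rfl⟩
  have hmin : 0 < min Δ 1 := lt_min hΔ one_pos
  have hΔ'0 : 0 < Δ' := by rw [hΔ']; linarith
  have hΔ'1 : Δ' ≤ 1 := by linarith [min_le_right Δ 1]
  have hΔ'Δ : 2 * Δ' ≤ Δ := by linarith [min_le_left Δ 1]
  obtain ⟨S, c, R, hS, hc, h⟩ := exists_rigid_subconfig hΔ'0 hΔ'1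
  have hS' : 1 ≤ S + 1 / Δ' := by
    have : 0 < 1 / Δ' := by positivity
    linarith
  have hC : 1 ≤ (S + 1 / Δ') ^ 3 := one_le_pow₀ hS'
  refine ⟨(S + 1 / Δ') ^ 3, c, R + 1, hC, hc, R.succ_pos, ?_⟩
  intro n m P L hP hL hline hn hm hmn hnm hI
  rcases n.eq_zero_or_pos with rfl | hn0
  · have h0 : RigidLE ∅ ∅ (R + 1) := fun _ _ _ => ⟨fun _ => 1, fun h => by
      simpa using congrFun h 0, by simp, by simp⟩
    refine ⟨∅, Set.empty_subset _, by simp, ?_⟩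
    simpa using h0.configRigid hline (by simp)
  have hn0' : (0 : ℝ) < n := by exact_mod_cast hn0
  rw [le_div_iff₀ (by positivity)] at hmn hnm
  have hm0 : (0 : ℝ) < m := by
    rcases m.eq_zero_or_pos with rfl | hm0
    · have : 0 < (n : ℝ) * (S + 1 / Δ') ^ 3 := by positivity
      rw [Nat.cast_zero, zero_pow two_ne_zero] at hnm
      exact absurd hnm (not_le.2 this)
    · exact_mod_cast hm0
  obtain ⟨s, t, hs, ht, hs3, ht3, hst, hts, hpow⟩ := exists_sizes hn0' hm0
  have hSs : S + 1 / Δ' ≤ s := by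
    refine le_of_pow_le_pow_left₀ three_ne_zero hs ?_
    rwa [hs3, le_div_iff₀ hm0, mul_comm]
  have hSt : S + 1 / Δ' ≤ t := by
    refine le_of_pow_le_pow_left₀ three_ne_zero ht ?_
    rwa [ht3, le_div_iff₀ hn0', mul_comm]
  have hΔt : 1 ≤ Δ' * t := by
    have : 1 / Δ' ≤ t := by linarith
    rwa [div_le_iff₀ hΔ'0, mul_comm] at this
  have hfin : (lineSet ⁻¹' L).Finite := hL.preimage lineSet_injective.injOn
  have hPn : (hP.toFinset.card : ℝ) = n := by
    rw [← hn, Set.ncard_eq_toFinset_card P hP]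
  have hLm : (hfin.toFinset.card : ℝ) ≤ m := by
    rw [← hm, ← Set.ncard_eq_toFinset_card _ hfin]
    exact_mod_cast Set.ncard_le_ncard_of_injOn lineSet (fun q hq => hq) lineSet_injective.injOn hL
  have hcount := card_incidences_le hP.toFinset hfin.toFinset L hline fun q hq => by simpa using hq
  rw [hP.coe_toFinset] at hcount
  have hcount' : ((Incidences P L).ncard : ℝ) ≤
      incCount hP.toFinset hfin.toFinset + n := by
    rw [← hPn]; exact_mod_cast hcount
  rw [mul_assoc, hpow] at hI
  have hI' : Δ' * (s * t) ^ 2 ≤ incCount hP.toFinset hfin.toFinset := by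
    have h1 : (n : ℝ) ≤ Δ' * (s * t) ^ 2 := by
      rw [← hst]
      calc s ^ 2 * t = 1 * (s ^ 2 * t) := (one_mul _).symm
        _ ≤ Δ' * t * (s ^ 2 * t) := by gcongr
        _ = _ := by ring
    have h2 : 2 * Δ' * (s * t) ^ 2 ≤ Δ * (s * t) ^ 2 := by gcongr
    linarith
  have hΔinv : 0 < 1 / Δ' := by positivity
  obtain ⟨A, hA, B, hB, hAB, hAc⟩ := h hP.toFinset hfin.toFinset s t (by linarith) (by linarith)
    (by rw [hst, hPn]) (by rwa [hts]) hI'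
  refine ⟨A, fun p hp => hP.mem_toFinset.1 (hA hp), ?_, ?_⟩
  · rwa [Set.ncard_coe_finset, ← hst]
  · exact (hAB.configRigid hline fun l hl => hfin.mem_toFinset.1 (hB hl)).mono R.le_succ
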